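/- arXiv:1606.07735 — 9 statements merged into one kernel-verified Lean document; each statement's English description precedes it below -/
import Mathlib

section
/- Let n, m ≥ 1 and T ∈ (0, ∞]. Let A : [0,T) → Matrix(n,n,ℝ), C : [0,T) → Matrix(m,n,ℝ), Q : [0,T) → Matrix(m,m,ℝ), V : [0,T) → Matrix(n,n,ℝ) be continuous, with Q(t) and V(t) symmetric positive semidefinite for all t, with the operator norm of A(t) bounded by a constant k_a on [0,T) and the trace of C(t)ᵀQ(t)C(t) bounded by a constant μ̄_q on [0,T). If P : [0,T) → Matrix(n,n,ℝ) is continuously differentiable, symmetric-valued, satisfies the CRE Ṗ(t) = A(t)P(t) + P(t)A(t)ᵀ − P(t)C(t)ᵀQ(t)C(t)P(t) + V(t) on [0,T), and P(0) is positive definite, then P(t) is positive definite for every t ∈ [0,T). -/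
open Matrix MeasureTheory
open scoped ENNReal

theorem cre_aux_trace {n : ℕ} (M : Matrix (Fin n) (Fin n) ℝ) (hM : M.PosSemidef)
    (x : Fin n → ℝ) : x ⬝ᵥ (M *ᵥ x) ≤ M.trace * (x ⬝ᵥ x) := by
  obtain ⟨B, rfl⟩ : ∃ B : Matrix (Fin n) (Fin n) ℝ, M = Bᴴ * B := by
    classical
    open scoped MatrixOrder in
    exact CStarAlgebra.nonneg_iff_eq_star_mul_self.mp hM.nonneg
  have h1 : x ⬝ᵥ ((Bᴴ * B) *ᵥ x) = ∑ i, (∑ j, B i j * x j) ^ 2 := by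
    rw [← Matrix.mulVec_mulVec, Matrix.dotProduct_mulVec, Matrix.conjTranspose_eq_transpose_of_trivial,
      Matrix.vecMul_transpose]
    simp [dotProduct, Matrix.mulVec, sq]
  have h2 : (Bᴴ * B).trace = ∑ i, ∑ j, B i j ^ 2 := by
    rw [Finset.sum_comm]
    simp [Matrix.trace, Matrix.mul_apply, sq]
  have h3 : x ⬝ᵥ x = ∑ j, x j ^ 2 := by simp [dotProduct, sq]
  rw [h1, h2, h3, Finset.sum_mul]
  exact Finset.sum_le_sum fun i _ => Finset.sum_mul_sq_le_sq_mul_sq _ _ _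

theorem cre_aux_norm {n : ℕ} (A : Matrix (Fin n) (Fin n) ℝ) (k : ℝ)
    (hA : ‖Matrix.toEuclideanCLM (𝕜 := ℝ) A‖ ≤ k)
    (x : Fin n → ℝ) : -(k * (x ⬝ᵥ x)) ≤ x ⬝ᵥ (A *ᵥ x) := by
  set y : EuclideanSpace ℝ (Fin n) := WithLp.toLp 2 x with hy
  have h1 : x ⬝ᵥ (A *ᵥ x) = inner ℝ y (Matrix.toEuclideanCLM (𝕜 := ℝ) A y) := by
    simp [hy, PiLp.inner_apply, dotProduct, mul_comm]
  have h2 : x ⬝ᵥ x = ‖y‖ * ‖y‖ := by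
    rw [← real_inner_self_eq_norm_mul_norm]
    simp only [hy, PiLp.inner_apply, dotProduct]
    simp [sq]
  have h3 := abs_real_inner_le_norm y (Matrix.toEuclideanCLM (𝕜 := ℝ) A y)
  have h4 : ‖Matrix.toEuclideanCLM (𝕜 := ℝ) A y‖ ≤ k * ‖y‖ :=
    ContinuousLinearMap.le_of_opNorm_le _ hA y
  have h5 := mul_le_mul_of_nonneg_left h4 (norm_nonneg y)
  rw [h1, h2]
  have := neg_abs_le (inner ℝ y (Matrix.toEuclideanCLM (𝕜 := ℝ) A y))
  linarith

theorem cre_aux_deriv (g : ℝ → ℝ) (g' t : ℝ) (ht : 0 < t) (s : Set ℝ) (hs : Set.Icc 0 t ⊆ s)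
    (hg : HasDerivWithinAt g g' s t) (hmin : ∀ u ∈ Set.Icc 0 t, g t ≤ g u) : g' ≤ 0 := by
  have h := (hg.mono hs).hasFDerivWithinAt
  have hm : IsLocalMinOn g (Set.Icc 0 t) t :=
    Filter.eventually_of_mem self_mem_nhdsWithin hmin
  have := hm.hasFDerivWithinAt_nonneg h (y := 0 - t)
    (sub_mem_posTangentConeAt_of_segment_subset
      ((convex_Icc 0 t).segment_subset (by simp [ht.le]) (by simp [ht.le])))
  simp at this
  by_contra hc
  push Not at hc
  nlinarith [mul_pos ht hc]

set_option maxHeartbeats 2000000 in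
/-- Positive definiteness of solutions of the Continuous Riccati Equation on `[0, T)`,
where `T ∈ (0, ∞]`. -/
theorem cre_posDef_on_interval
    (n m : ℕ) (hn : 1 ≤ n) (hm : 1 ≤ m) (T : ℝ≥0∞) (hT : 0 < T)
    (A P V : ℝ → Matrix (Fin n) (Fin n) ℝ)
    (C : ℝ → Matrix (Fin m) (Fin n) ℝ)
    (Q : ℝ → Matrix (Fin m) (Fin m) ℝ)
    (D : Set ℝ) (hD : D = {t : ℝ | 0 ≤ t ∧ ENNReal.ofReal t < T})
    (hAcont : ContinuousOn A D) (hCcont : ContinuousOn C D)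
    (hQcont : ContinuousOn Q D) (hVcont : ContinuousOn V D)
    (hQ : ∀ t ∈ D, (Q t).PosSemidef) (hV : ∀ t ∈ D, (V t).PosSemidef)
    (k_a : ℝ) (hA : ∀ t ∈ D, ‖Matrix.toEuclideanCLM (𝕜 := ℝ) (A t)‖ ≤ k_a)
    (μq : ℝ) (hCQ : ∀ t ∈ D, ((C t)ᵀ * Q t * C t).trace ≤ μq)
    (hPsymm : ∀ t ∈ D, (P t).IsSymm)
    (hCRE : ∀ t ∈ D, ∀ i j, HasDerivWithinAt (fun τ => P τ i j)
      ((A t * P t + P t * (A t)ᵀ - P t * (C t)ᵀ * Q t * C t * P t + V t) i j) D t)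
    (hP0 : (P 0).PosDef) :
    ∀ t ∈ D, (P t).PosDef := by
  intro t1 ht1
  have ht1' : 0 ≤ t1 := by rw [hD] at ht1; exact ht1.1
  have hsub : Set.Icc 0 t1 ⊆ D := by
    intro s hs
    rw [hD] at ht1 ⊢
    exact ⟨hs.1, (ENNReal.ofReal_le_ofReal hs.2).trans_lt ht1.2⟩
  have hPc : ContinuousOn P (Set.Icc 0 t1) := by
    refine continuousOn_pi.2 fun i => continuousOn_pi.2 fun j t ht => ?_
    exact ((hCRE t (hsub ht) i j).continuousWithinAt).mono hsub
  have hxx : ∀ x : Fin n → ℝ, x ≠ 0 → 0 < x ⬝ᵥ x := fun x hx => by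
    simpa using Matrix.dotProduct_star_self_pos_iff.2 hx
  -- constants
  obtain ⟨ε, hε0, hε1, hεP⟩ : ∃ ε : ℝ, 0 < ε ∧ ε ≤ 1 ∧
      ∀ x ∈ Metric.sphere (0 : Fin n → ℝ) 1, ε * (x ⬝ᵥ x) < x ⬝ᵥ (P 0 *ᵥ x) := by
    have : Nonempty (Fin n) := ⟨⟨0, hn⟩⟩
    have hx0 : ∀ x ∈ Metric.sphere (0 : Fin n → ℝ) 1, x ≠ 0 := by
      intro x hx h0
      simp [h0] at hx
    obtain ⟨x0, hx0m, hmin⟩ := (isCompact_sphere (0 : Fin n → ℝ) 1).exists_isMinOn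
      (NormedSpace.sphere_nonempty.2 zero_le_one)
      (f := fun x => (x ⬝ᵥ (P 0 *ᵥ x)) / (x ⬝ᵥ x)) (by
        refine ContinuousOn.div (by fun_prop) (by fun_prop) ?_
        intro x hx
        exact (hxx x (hx0 x hx)).ne')
    set c := (x0 ⬝ᵥ (P 0 *ᵥ x0)) / (x0 ⬝ᵥ x0) with hc
    have hcpos : 0 < c := by
      refine div_pos ?_ (hxx x0 (hx0 x0 hx0m))
      simpa using hP0.dotProduct_mulVec_pos (hx0 x0 hx0m)
    refine ⟨min 1 (c / 2), by positivity, min_le_left _ _, fun x hx => ?_⟩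
    have h1 : c ≤ (x ⬝ᵥ (P 0 *ᵥ x)) / (x ⬝ᵥ x) := hmin hx
    have h2 := hxx x (hx0 x hx)
    rw [le_div_iff₀ h2] at h1
    have h3 : min 1 (c / 2) < c := (min_le_right _ _).trans_lt (by linarith)
    nlinarith
  set K : ℝ := 2 * |k_a| + |μq| + 1 with hK
  have hK0 : 0 < K := by positivity
  let G : ℝ → (Fin n → ℝ) → ℝ := fun t x =>
    x ⬝ᵥ (P t *ᵥ x) - ε * Real.exp (-K * t) * (x ⬝ᵥ x)
  -- main claim
  have main : ∀ t ∈ Set.Icc 0 t1, ∀ x ∈ Metric.sphere (0 : Fin n → ℝ) 1, 0 < G t x := by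
    by_contra hcon
    push Not at hcon
    obtain ⟨t2, ht2, x2, hx2, hG2⟩ := hcon
    have hcomp : IsCompact (Set.Icc 0 t1 ×ˢ Metric.sphere (0 : Fin n → ℝ) 1) :=
      isCompact_Icc.prod (isCompact_sphere _ _)
    have hGc : ContinuousOn (fun p : ℝ × (Fin n → ℝ) => G p.1 p.2)
        (Set.Icc 0 t1 ×ˢ Metric.sphere (0 : Fin n → ℝ) 1) := by
      have hP' : ContinuousOn (fun p : ℝ × (Fin n → ℝ) => P p.1)
          (Set.Icc 0 t1 ×ˢ Metric.sphere (0 : Fin n → ℝ) 1) :=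
        hPc.comp continuousOn_fst fun p hp => hp.1
      have hPij : ∀ i j, ContinuousOn (fun p : ℝ × (Fin n → ℝ) => P p.1 i j)
          (Set.Icc 0 t1 ×ˢ Metric.sphere (0 : Fin n → ℝ) 1) := fun i j =>
        continuousOn_pi.1 (continuousOn_pi.1 hP' i) j
      have hxi : ∀ i, ContinuousOn (fun p : ℝ × (Fin n → ℝ) => p.2 i)
          (Set.Icc 0 t1 ×ˢ Metric.sphere (0 : Fin n → ℝ) 1) := fun i =>
        ((continuous_apply i).comp continuous_snd).continuousOn
      simp only [G, dotProduct, Matrix.mulVec]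
      refine ContinuousOn.sub ?_ (ContinuousOn.mul ?_ ?_)
      · exact continuousOn_finsetSum _ fun i _ => (hxi i).mul
          (continuousOn_finsetSum _ fun j _ => (hPij i j).mul (hxi j))
      · exact Continuous.continuousOn (by fun_prop)
      · exact continuousOn_finsetSum _ fun i _ => (hxi i).mul (hxi i)
    have hZ : IsCompact ((Set.Icc 0 t1 ×ˢ Metric.sphere (0 : Fin n → ℝ) 1) ∩
        (fun p : ℝ × (Fin n → ℝ) => G p.1 p.2) ⁻¹' Set.Iic 0) :=
      hcomp.of_isClosed_subset (hGc.preimage_isClosed_of_isClosed hcomp.isClosed isClosed_Iic)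
        Set.inter_subset_left
    obtain ⟨⟨t, x⟩, ⟨⟨ht, hx⟩, hGx⟩, hmin⟩ := hZ.exists_isMinOn ⟨(t2, x2), ⟨ht2, hx2⟩, hG2⟩
      continuousOn_fst
    simp only [Set.mem_preimage, Set.mem_Iic] at ht hx hGx
    have hbefore : ∀ s ∈ Set.Icc 0 t1, s < t → ∀ y ∈ Metric.sphere (0 : Fin n → ℝ) 1,
        0 < G s y := by
      intro s hs hst y hy
      by_contra hc
      push Not at hc
      have := hmin (show (s, y) ∈ _ from ⟨⟨hs, hy⟩, hc⟩)
      simp only [Set.mem_ofPred_eq] at this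
      linarith
    have htpos : 0 < t := by
      rcases ht.1.eq_or_lt with h | h
      · exfalso
        rw [← h] at hGx
        have := hεP x hx
        simp [G] at hGx
        linarith
      · exact h
    have hGt : ∀ y ∈ Metric.sphere (0 : Fin n → ℝ) 1, 0 ≤ G t y := by
      intro y hy
      have hc : ContinuousOn (fun s => G s y) (Set.Icc 0 t1) :=
        hGc.comp (f := fun s => (s, y)) (by fun_prop) fun s hs => ⟨hs, hy⟩
      have hc1 : ContinuousWithinAt (fun s => G s y) (Set.Ico 0 t) t :=
        (hc t ht).mono fun s hs => ⟨hs.1, hs.2.le.trans ht.2⟩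
      have : (nhdsWithin t (Set.Ico 0 t)).NeBot := by
        rw [← mem_closure_iff_nhdsWithin_neBot, closure_Ico htpos.ne]
        exact ⟨ht.1, le_rfl⟩
      refine ge_of_tendsto hc1 (Filter.eventually_of_mem self_mem_nhdsWithin ?_)
      intro s hs
      exact (hbefore s ⟨hs.1, hs.2.le.trans ht.2⟩ hs.2 y hy).le
    have hG0 : G t x = 0 := le_antisymm hGx (hGt x hx)
    have htD : t ∈ D := hsub ht
    have hxne : x ≠ 0 := by
      intro h0
      simp [h0] at hx
    have hxp := hxx x hxne
    set l : ℝ := ε * Real.exp (-K * t) with hl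
    have hl0 : 0 < l := by positivity
    have hl1 : l ≤ 1 := by
      have : Real.exp (-K * t) ≤ 1 := Real.exp_le_one_iff.2 (by nlinarith)
      exact mul_le_one₀ hε1 (Real.exp_pos _).le this
    have hRq : ∀ y : Fin n → ℝ, y ⬝ᵥ ((P t - l • (1 : Matrix (Fin n) (Fin n) ℝ)) *ᵥ y) = G t y := by
      intro y
      simp [G, Matrix.sub_mulVec, Matrix.smul_mulVec, dotProduct_sub, hl]
    have hR : (P t - l • (1 : Matrix (Fin n) (Fin n) ℝ)).PosSemidef := by
      refine Matrix.PosSemidef.of_dotProduct_mulVec_nonneg ?_ ?_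
      · have := hPsymm t htD
        simp only [Matrix.IsHermitian, Matrix.conjTranspose_eq_transpose_of_trivial,
          Matrix.transpose_sub, Matrix.transpose_smul, Matrix.transpose_one, this.eq]
      · intro y
        rw [star_trivial]
        by_cases hy : y = 0
        · simp [hy]
        have hny : 0 < ‖y‖ := norm_pos_iff.2 hy
        have h1 := hGt (‖y‖⁻¹ • y) (by simp [norm_smul, hny.ne'])
        rw [← hRq] at h1
        simp only [Matrix.mulVec_smul, smul_dotProduct, dotProduct_smul, smul_eq_mul] at h1
        have h2 : 0 < ‖y‖⁻¹ := by positivity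
        exact nonneg_of_mul_nonneg_right (nonneg_of_mul_nonneg_right h1 h2) h2
    have hPx : P t *ᵥ x = l • x := by
      have h1 : (P t - l • (1 : Matrix (Fin n) (Fin n) ℝ)) *ᵥ x = 0 := by
        rw [← hR.dotProduct_mulVec_zero_iff, star_trivial, hRq, hG0]
      simpa [Matrix.sub_mulVec, Matrix.smul_mulVec, sub_eq_zero] using h1
    have hxP : x ᵥ* P t = l • x := by
      rw [← hPx, ← Matrix.mulVec_transpose, (hPsymm t htD).eq]
    set W := A t * P t + P t * (A t)ᵀ - P t * (C t)ᵀ * Q t * C t * P t + V t with hW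
    have hder1 : HasDerivWithinAt (fun s => x ⬝ᵥ (P s *ᵥ x)) (x ⬝ᵥ (W *ᵥ x)) D t := by
      simp only [dotProduct, Matrix.mulVec]
      refine HasDerivWithinAt.fun_sum fun i _ => HasDerivWithinAt.const_mul _ ?_
      exact HasDerivWithinAt.fun_sum fun j _ => (hCRE t htD i j).mul_const _
    have hder2 : HasDerivWithinAt (fun s => ε * Real.exp (-K * s) * (x ⬝ᵥ x))
        (-K * l * (x ⬝ᵥ x)) D t := by
      have h0 : HasDerivAt (fun s : ℝ => -K * s) (-K) t := by
        simpa using (hasDerivAt_id t).const_mul (-K)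
      have := ((h0.exp.const_mul ε).mul_const (x ⬝ᵥ x)).hasDerivWithinAt (s := D)
      have he : -K * l * (x ⬝ᵥ x) = ε * (Real.exp (-K * t) * -K) * (x ⬝ᵥ x) := by
        rw [hl]; ring
      rw [he]
      exact this
    have hder : HasDerivWithinAt (fun s => G s x) (x ⬝ᵥ (W *ᵥ x) - -K * l * (x ⬝ᵥ x)) D t :=
      hder1.sub hder2
    have hle := cre_aux_deriv _ _ t htpos D
      (fun s hs => hsub ⟨hs.1, hs.2.trans ht.2⟩) hder (by
        intro u hu
        show G t x ≤ G u x
        rw [hG0]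
        rcases hu.2.eq_or_lt with h | h
        · rw [h, hG0]
        · exact (hbefore u ⟨hu.1, hu.2.trans ht.2⟩ h x hx).le)
    have hM : ((C t)ᵀ * Q t * C t).PosSemidef := by
      simpa using (hQ t htD).conjTranspose_mul_mul_same (C t)
    have hWx : x ⬝ᵥ (W *ᵥ x) = 2 * l * (x ⬝ᵥ (A t *ᵥ x))
        - l * (l * (x ⬝ᵥ (((C t)ᵀ * Q t * C t) *ᵥ x))) + x ⬝ᵥ (V t *ᵥ x) := by
      have e1 : x ⬝ᵥ ((A t * P t) *ᵥ x) = l * (x ⬝ᵥ (A t *ᵥ x)) := by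
        rw [← Matrix.mulVec_mulVec, hPx, Matrix.mulVec_smul, dotProduct_smul, smul_eq_mul]
      have e2 : x ⬝ᵥ ((P t * (A t)ᵀ) *ᵥ x) = l * (x ⬝ᵥ (A t *ᵥ x)) := by
        rw [← Matrix.mulVec_mulVec, Matrix.dotProduct_mulVec, hxP, smul_dotProduct, smul_eq_mul,
          Matrix.mulVec_transpose, dotProduct_comm, ← Matrix.dotProduct_mulVec]
      have e3 : x ⬝ᵥ ((P t * (C t)ᵀ * Q t * C t * P t) *ᵥ x)
          = l * (l * (x ⬝ᵥ (((C t)ᵀ * Q t * C t) *ᵥ x))) := by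
        have : P t * (C t)ᵀ * Q t * C t * P t = P t * (((C t)ᵀ * Q t * C t) * P t) := by
          simp only [Matrix.mul_assoc]
        rw [this, ← Matrix.mulVec_mulVec, Matrix.dotProduct_mulVec, hxP, smul_dotProduct,
          smul_eq_mul, ← Matrix.mulVec_mulVec, hPx, Matrix.mulVec_smul, dotProduct_smul,
          smul_eq_mul]
      rw [hW, Matrix.add_mulVec, Matrix.sub_mulVec, Matrix.add_mulVec, dotProduct_add,
        dotProduct_sub, dotProduct_add, e1, e2, e3]
      ring
    have hVx : 0 ≤ x ⬝ᵥ (V t *ᵥ x) := by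
      simpa using (hV t htD).dotProduct_mulVec_nonneg x
    have hAx := cre_aux_norm (A t) |k_a| ((hA t htD).trans (le_abs_self _)) x
    have hMx : x ⬝ᵥ (((C t)ᵀ * Q t * C t) *ᵥ x) ≤ |μq| * (x ⬝ᵥ x) :=
      (cre_aux_trace _ hM x).trans
        (mul_le_mul_of_nonneg_right ((hCQ t htD).trans (le_abs_self _)) hxp.le)
    have hMx2 : l * (x ⬝ᵥ (((C t)ᵀ * Q t * C t) *ᵥ x)) ≤ |μq| * (x ⬝ᵥ x) := by
      have h0 : 0 ≤ |μq| * (x ⬝ᵥ x) := by positivity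
      calc _ ≤ l * (|μq| * (x ⬝ᵥ x)) := mul_le_mul_of_nonneg_left hMx hl0.le
        _ ≤ _ := mul_le_of_le_one_left h0 hl1
    rw [hWx] at hle
    have hpos : 0 < l * (2 * (x ⬝ᵥ (A t *ᵥ x))
        - l * (x ⬝ᵥ (((C t)ᵀ * Q t * C t) *ᵥ x)) + K * (x ⬝ᵥ x)) := by
      refine mul_pos hl0 ?_
      rw [hK]
      linarith
    linarith
  refine Matrix.PosDef.of_dotProduct_mulVec_pos ?_ ?_
  · simpa [Matrix.IsHermitian] using (hPsymm t1 ht1).eq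
  · intro y hy
    rw [star_trivial]
    have hny : 0 < ‖y‖ := norm_pos_iff.2 hy
    have h1 := main t1 ⟨ht1', le_rfl⟩ (‖y‖⁻¹ • y) (by simp [norm_smul, hny.ne'])
    have hp : 0 ≤ ε * Real.exp (-K * t1) * ((‖y‖⁻¹ • y) ⬝ᵥ (‖y‖⁻¹ • y)) :=
      mul_nonneg (by positivity) (Finset.sum_nonneg fun i _ => mul_self_nonneg _)
    have h3 : 0 < (‖y‖⁻¹ • y) ⬝ᵥ (P t1 *ᵥ (‖y‖⁻¹ • y)) := by
      have : G t1 (‖y‖⁻¹ • y) = _ - _ := rfl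
      linarith
    simp only [Matrix.mulVec_smul, smul_dotProduct, dotProduct_smul, smul_eq_mul] at h3
    have h2 : 0 < ‖y‖⁻¹ := by positivity
    exact pos_of_mul_pos_right (pos_of_mul_pos_right h3 h2.le) h2.le
end

section
/- Let P : [0,T] → Matrix(n,n,ℝ) be continuously differentiable and satisfy the CRE Ṗ(t) = A(t)P(t) + P(t)A(t)ᵀ − P(t)C(t)ᵀQ(t)C(t)P(t) + V(t), with P(t) symmetric positive semidefinite for all t ∈ [0,T], Q(t) symmetric positive semidefinite, the operator norm of A(t) bounded by k_a > 0, and tr(V(t)) ≤ v̄ for all t. Then for all t ∈ [0,T], tr(P(t)) ≤ (tr(P(0)) + v̄/(2 k_a))·exp(2 k_a t) − v̄/(2 k_a). In particular tr(P(t)) cannot diverge to infinity in finite time. -/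
open Matrix MeasureTheory

lemma cre_trace_mul_le {n : ℕ} (A P : Matrix (Fin n) (Fin n) ℝ) (hP : P.PosSemidef) (k : ℝ)
    (hA : ‖Matrix.toEuclideanCLM (𝕜 := ℝ) A‖ ≤ k) : (A * P).trace ≤ k * P.trace := by
  obtain ⟨B, rfl⟩ : ∃ B : Matrix (Fin n) (Fin n) ℝ, P = Bᴴ * B := by
    open scoped MatrixOrder in
    exact CStarAlgebra.nonneg_iff_eq_star_mul_self.mp hP.nonneg
  have h1 : (A * (Bᴴ * B)).trace = ∑ i, B i ⬝ᵥ (A *ᵥ B i) := by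
    rw [← Matrix.mul_assoc, Matrix.trace_mul_comm]
    rfl
  have h2 : (Bᴴ * B).trace = ∑ i, B i ⬝ᵥ B i := by
    rw [Matrix.trace_mul_comm]
    rfl
  rw [h1, h2, Finset.mul_sum]
  refine Finset.sum_le_sum fun i _ => ?_
  set x : EuclideanSpace ℝ (Fin n) := WithLp.toLp 2 (B i) with hx
  have e1 : B i ⬝ᵥ (A *ᵥ B i) = inner ℝ x (Matrix.toEuclideanCLM (𝕜 := ℝ) A x) := by
    rw [EuclideanSpace.inner_eq_star_dotProduct, dotProduct_comm]
    simp [hx]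
  have e2 : B i ⬝ᵥ B i = ‖x‖ * ‖x‖ := by
    rw [← real_inner_self_eq_norm_mul_norm, EuclideanSpace.inner_eq_star_dotProduct]
    simp [hx]
  rw [e1, e2]
  calc _ ≤ ‖x‖ * ‖Matrix.toEuclideanCLM (𝕜 := ℝ) A x‖ := real_inner_le_norm _ _
    _ ≤ ‖x‖ * (k * ‖x‖) := by
        gcongr
        exact (ContinuousLinearMap.le_opNorm _ _).trans (by gcongr)
    _ = _ := by ring

/-- The trace of a positive semidefinite solution of the Continuous Riccati Equation
grows at most exponentially: `tr(P(t)) ≤ (tr(P(0)) + v̄/(2k_a)) exp(2 k_a t) − v̄/(2 k_a)`,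
hence cannot diverge in finite time. -/
theorem cre_trace_upper_bound
    (n m : ℕ) (T : ℝ) (hT : 0 ≤ T)
    (A P V : ℝ → Matrix (Fin n) (Fin n) ℝ)
    (C : ℝ → Matrix (Fin m) (Fin n) ℝ)
    (Q : ℝ → Matrix (Fin m) (Fin m) ℝ)
    (hCRE : ∀ t ∈ Set.Icc 0 T, ∀ i j, HasDerivWithinAt (fun τ => P τ i j)
      ((A t * P t + P t * (A t)ᵀ - P t * (C t)ᵀ * Q t * C t * P t + V t) i j)
      (Set.Icc 0 T) t)
    (hP : ∀ t ∈ Set.Icc 0 T, (P t).PosSemidef)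
    (hQ : ∀ t ∈ Set.Icc 0 T, (Q t).PosSemidef)
    (k_a : ℝ) (hka : 0 < k_a)
    (hA : ∀ t ∈ Set.Icc 0 T, ‖Matrix.toEuclideanCLM (𝕜 := ℝ) (A t)‖ ≤ k_a)
    (v : ℝ) (hV : ∀ t ∈ Set.Icc 0 T, (V t).trace ≤ v) :
    ∀ t ∈ Set.Icc 0 T,
      (P t).trace ≤ ((P 0).trace + v / (2 * k_a)) * Real.exp (2 * k_a * t) - v / (2 * k_a) := by
  have hd : ∀ t ∈ Set.Icc 0 T, HasDerivWithinAt (fun τ => (P τ).trace)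
      ((A t * P t + P t * (A t)ᵀ - P t * (C t)ᵀ * Q t * C t * P t + V t).trace)
      (Set.Icc 0 T) t := by
    intro t ht
    exact HasDerivWithinAt.fun_sum fun i _ => hCRE t ht i i
  have hb : ∀ t ∈ Set.Icc 0 T,
      (A t * P t + P t * (A t)ᵀ - P t * (C t)ᵀ * Q t * C t * P t + V t).trace
        ≤ 2 * k_a * (P t).trace + v := by
    intro t ht
    have hs : (P t)ᵀ = P t := (hP t ht).isHermitian
    have h1 := cre_trace_mul_le _ _ (hP t ht) k_a (hA t ht)
    have h2 : (P t * (A t)ᵀ).trace = (A t * P t).trace := by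
      rw [← Matrix.trace_transpose, Matrix.transpose_mul, Matrix.transpose_transpose, hs]
    have h3 : 0 ≤ (P t * (C t)ᵀ * Q t * C t * P t).trace := by
      have := ((hQ t ht).conjTranspose_mul_mul_same (C t * P t)).trace_nonneg
      rw [Matrix.conjTranspose_eq_transpose_of_trivial, Matrix.transpose_mul, hs] at this
      simpa only [Matrix.mul_assoc] using this
    have h4 := hV t ht
    rw [Matrix.trace_add, Matrix.trace_sub, Matrix.trace_add, h2]
    linarith
  have hg : ∀ t ∈ Set.Icc 0 T, HasDerivWithinAt
      (fun τ => ((P τ).trace + v / (2 * k_a)) * Real.exp (-(2 * k_a * τ)))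
      ((A t * P t + P t * (A t)ᵀ - P t * (C t)ᵀ * Q t * C t * P t + V t).trace
          * Real.exp (-(2 * k_a * t))
        + ((P t).trace + v / (2 * k_a)) * (Real.exp (-(2 * k_a * t)) * (-(2 * k_a * 1))))
      (Set.Icc 0 T) t := by
    intro t ht
    exact ((hd t ht).add_const _).mul
      ((((hasDerivAt_id t).const_mul (2 * k_a)).neg.exp).hasDerivWithinAt)
  have hanti : AntitoneOn (fun τ => ((P τ).trace + v / (2 * k_a)) * Real.exp (-(2 * k_a * τ)))
      (Set.Icc 0 T) := by
    refine antitoneOn_of_hasDerivWithinAt_nonpos (convex_Icc 0 T)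
      (fun t ht => (hg t ht).continuousWithinAt)
      (fun t ht => (hg t (interior_subset ht)).mono interior_subset) ?_
    intro t ht
    have h1 := hb t (interior_subset ht)
    have h2 := Real.exp_pos (-(2 * k_a * t))
    have h3 : v / (2 * k_a) * (2 * k_a) = v := by field_simp
    have h4 := mul_le_mul_of_nonneg_right h1 h2.le
    linear_combination h4 - Real.exp (-(2 * k_a * t)) * h3
  intro t ht
  have h := hanti ⟨le_rfl, hT⟩ ht ht.1
  simp only [mul_zero, neg_zero, Real.exp_zero, mul_one] at h
  rw [Real.exp_neg, ← div_eq_mul_inv, div_le_iff₀ (Real.exp_pos _)] at h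
  linarith
end

section
/- Let A ∈ Matrix(n,n,ℝ) be a constant matrix all of whose complex eigenvalues are real, and let C̄ ∈ Matrix(m,n,ℝ) be a constant matrix such that the Kalman observability matrix obtained by stacking C̄, C̄A, …, C̄A^{n−1} has rank n. Let y : ℝ → ℝ^m be continuous with |y(t)| = 1 for all t, and suppose there exist δ > 0 and ε > 0 such that (1/δ)∫_t^{t+δ}(I − y(s)y(s)ᵀ) ds ≥ ε·I_m for all t ≥ 0. Then there exist δ̄ > 0 and μ > 0 such that for all t ≥ 0, (1/δ̄)∫_t^{t+δ̄} exp(A(s−t))ᵀ · C̄ᵀ (I − y(s)y(s)ᵀ) C̄ · exp(A(s−t)) ds ≥ μ·I_n. -/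
open Matrix MeasureTheory

/-- Entrywise integral of a matrix-valued function. -/
noncomputable def matInt {ι κ : Type*} (f : ℝ → Matrix ι κ ℝ) (a b : ℝ) : Matrix ι κ ℝ :=
  Matrix.of fun i j => ∫ s in a..b, f s i j

open Filter Topology

lemma aux_iSup {n : ℕ} (A : Matrix (Fin n) (Fin n) ℝ)
    (hreal : ∀ μ ∈ spectrum ℂ (A.map (algebraMap ℝ ℂ)), μ.im = 0) (x : Fin n → ℝ) :
    x ∈ ⨆ l : ℝ, Module.End.maxGenEigenspace (Matrix.toLin' A) l := by
  have key : ∀ z : Fin n → ℂ, (fun i => (z i).re) ∈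
      ⨆ l : ℝ, Module.End.maxGenEigenspace (Matrix.toLin' A) l := by
    intro z
    have hz : z ∈ ⨆ μ : ℂ, Module.End.maxGenEigenspace
        (Matrix.toLin' (A.map (algebraMap ℝ ℂ))) μ := by
      rw [Module.End.iSup_maxGenEigenspace_eq_top]; trivial
    induction hz using Submodule.iSup_induction' with
    | zero => exact Submodule.zero_mem _
    | add a b _ _ ha hb => exact Submodule.add_mem _ ha hb
    | mem μ z hz =>
      by_cases h0 : z = 0
      · subst h0; exact Submodule.zero_mem _
      obtain ⟨N, hN⟩ := (Module.End.mem_maxGenEigenspace _ _ _).1 hz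
      have hμ : μ.im = 0 := by
        apply hreal
        rw [← Matrix.spectrum_toLin', ← Module.End.hasEigenvalue_iff_mem_spectrum]
        by_contra hne
        have hinj : Function.Injective
            (Matrix.toLin' (A.map (algebraMap ℝ ℂ)) - μ • (1 : Module.End ℂ (Fin n → ℂ))) := by
          rw [← LinearMap.ker_eq_bot]
          by_contra hk
          apply hne
          rw [Module.End.hasEigenvalue_iff, Module.End.eigenspace_def]
          simpa [Algebra.algebraMap_eq_smul_one] using hk
        have := hinj.iterate N
        rw [← Module.End.coe_pow] at this
        exact h0 (this (by rw [hN, map_zero]))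
      refine Submodule.mem_iSup_of_mem μ.re ?_
      rw [Module.End.mem_maxGenEigenspace]
      refine ⟨N, ?_⟩
      have hμ' : μ = (μ.re : ℂ) := by apply Complex.ext <;> simp [hμ]
      have step : ∀ w : Fin n → ℂ, (fun i => (((Matrix.toLin' (A.map (algebraMap ℝ ℂ))
          - μ • (1 : Module.End ℂ (Fin n → ℂ))) w) i).re) =
          (Matrix.toLin' A - μ.re • (1 : Module.End ℝ (Fin n → ℝ))) (fun i => (w i).re) := by
        intro w
        ext i
        rw [hμ']
        simp [Matrix.mulVec, dotProduct]
      have steps : ∀ (k : ℕ) (w : Fin n → ℂ), (fun i => (((Matrix.toLin' (A.map (algebraMap ℝ ℂ))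
          - μ • (1 : Module.End ℂ (Fin n → ℂ))) ^ k) w i).re) =
          ((Matrix.toLin' A - μ.re • (1 : Module.End ℝ (Fin n → ℝ))) ^ k) (fun i => (w i).re) := by
        intro k
        induction k with
        | zero => intro w; simp
        | succ k ih =>
          intro w
          rw [pow_succ, pow_succ, Module.End.mul_apply, Module.End.mul_apply, ih, step]
      rw [← steps, hN]
      rfl
  simpa using key (fun i => (x i : ℂ))

lemma aux_decomp {n : ℕ} (A : Matrix (Fin n) (Fin n) ℝ)
    (hreal : ∀ μ ∈ spectrum ℂ (A.map (algebraMap ℝ ℂ)), μ.im = 0) (x : Fin n → ℝ) :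
    ∃ (S : Finset ℝ) (f : ℝ → Fin n → ℝ), x = ∑ l ∈ S, f l ∧
      ∀ l, ∃ N, (A - l • (1 : Matrix (Fin n) (Fin n) ℝ)) ^ N *ᵥ f l = 0 := by
  obtain ⟨f, hf, hs⟩ := (Submodule.mem_iSup_iff_exists_finsupp _ _).1 (aux_iSup A hreal x)
  refine ⟨f.support, f, hs.symm, fun l => ?_⟩
  obtain ⟨N, hN⟩ := (Module.End.mem_maxGenEigenspace _ _ _).1 (hf l)
  refine ⟨N, ?_⟩
  rw [← hN, ← Matrix.toLin'_apply, Matrix.toLin'_pow, map_sub, map_smul, Matrix.toLin'_one]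
  rfl

lemma aux_exp_hasSum {n : ℕ} (M : Matrix (Fin n) (Fin n) ℝ) :
    HasSum (fun k : ℕ => ((k.factorial : ℝ)⁻¹) • M ^ k) (NormedSpace.exp M) := by
  let : SeminormedRing (Matrix (Fin n) (Fin n) ℝ) := Matrix.linftyOpSemiNormedRing
  let : NormedRing (Matrix (Fin n) (Fin n) ℝ) := Matrix.linftyOpNormedRing
  let : NormedAlgebra ℝ (Matrix (Fin n) (Fin n) ℝ) := Matrix.linftyOpNormedAlgebra
  exact NormedSpace.exp_series_hasSum_exp' (𝕂 := ℝ) M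

lemma aux_exp_cont {n : ℕ} (A : Matrix (Fin n) (Fin n) ℝ) :
    Continuous (fun s : ℝ => NormedSpace.exp (s • A)) := by
  let : SeminormedRing (Matrix (Fin n) (Fin n) ℝ) := Matrix.linftyOpSemiNormedRing
  let : NormedRing (Matrix (Fin n) (Fin n) ℝ) := Matrix.linftyOpNormedRing
  let : NormedAlgebra ℝ (Matrix (Fin n) (Fin n) ℝ) := Matrix.linftyOpNormedAlgebra
  let : NormedAlgebra ℚ (Matrix (Fin n) (Fin n) ℝ) := NormedAlgebra.restrictScalars ℚ ℝ _
  exact NormedSpace.exp_continuous.comp (continuous_id.smul continuous_const)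

lemma aux_exp_nil {n : ℕ} (M : Matrix (Fin n) (Fin n) ℝ) (N : ℕ) (v : Fin n → ℝ)
    (h : M ^ N *ᵥ v = 0) :
    NormedSpace.exp M *ᵥ v = ∑ k ∈ Finset.range N, ((k.factorial : ℝ)⁻¹) • (M ^ k *ᵥ v) := by
  have h1 : HasSum (fun k : ℕ => (((k.factorial : ℝ)⁻¹) • M ^ k) *ᵥ v)
      (NormedSpace.exp M *ᵥ v) := by
    have := (aux_exp_hasSum M).map (⟨⟨fun M => M *ᵥ v, Matrix.zero_mulVec v⟩,
      fun a b => Matrix.add_mulVec a b v⟩ : Matrix (Fin n) (Fin n) ℝ →+ (Fin n → ℝ))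
      (Continuous.matrix_mulVec continuous_id continuous_const)
    exact this
  have h2 := hasSum_sum_of_ne_finset_zero (L := SummationFilter.unconditional ℕ) (s := Finset.range N)
    (f := fun k : ℕ => (((k.factorial : ℝ)⁻¹) • M ^ k) *ᵥ v) (by
      intro b hb
      have hb' : N ≤ b := by simpa using hb
      obtain ⟨c, rfl⟩ := Nat.exists_eq_add_of_le' hb'
      simp only [Matrix.smul_mulVec]
      rw [pow_add, ← Matrix.mulVec_mulVec, h]; simp)
  rw [h1.unique h2]
  simp only [Matrix.smul_mulVec]

lemma aux_exp_gen {n : ℕ} (A : Matrix (Fin n) (Fin n) ℝ) (l : ℝ) (N : ℕ) (v : Fin n → ℝ)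
    (h : (A - l • (1 : Matrix (Fin n) (Fin n) ℝ)) ^ N *ᵥ v = 0) (s : ℝ) :
    NormedSpace.exp (s • A) *ᵥ v = ∑ k ∈ Finset.range N,
      (Real.exp (l * s) * s ^ k * ((k.factorial : ℝ)⁻¹)) •
        ((A - l • (1 : Matrix (Fin n) (Fin n) ℝ)) ^ k *ᵥ v) := by
  have e1 : s • A = (s * l) • (1 : Matrix (Fin n) (Fin n) ℝ) +
      s • (A - l • (1 : Matrix (Fin n) (Fin n) ℝ)) := by
    rw [smul_sub, smul_smul]; abel
  have e2 : NormedSpace.exp ((s * l) • (1 : Matrix (Fin n) (Fin n) ℝ)) =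
      Real.exp (l * s) • (1 : Matrix (Fin n) (Fin n) ℝ) := by
    have hd : ∀ c : ℝ, c • (1 : Matrix (Fin n) (Fin n) ℝ) = diagonal (fun _ => c) := by
      intro c; rw [Matrix.smul_one_eq_diagonal]
    rw [hd, hd, Matrix.exp_diagonal]
    congr 1
    ext i
    rw [Pi.coe_exp, ← Real.exp_eq_exp_ℝ, mul_comm]
  rw [e1, Matrix.exp_add_of_commute _ _ ((Commute.one_left _).smul_left _), e2, smul_mul_assoc,
    one_mul, Matrix.smul_mulVec, aux_exp_nil _ N, Finset.smul_sum]
  · refine Finset.sum_congr rfl fun k _ => ?_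
    rw [smul_pow, Matrix.smul_mulVec, smul_smul, smul_smul]
    congr 1; ring
  · rw [smul_pow, Matrix.smul_mulVec, h, smul_zero]

lemma aux_asymp {n : ℕ} (A : Matrix (Fin n) (Fin n) ℝ)
    (hreal : ∀ μ ∈ spectrum ℂ (A.map (algebraMap ℝ ℂ)), μ.im = 0) (x : Fin n → ℝ) (hx : x ≠ 0) :
    ∃ (l : ℝ) (v : Fin n → ℝ) (c : ℝ → ℝ), v ≠ 0 ∧ A *ᵥ v = l • v ∧
      Tendsto (fun s : ℝ => c s • (NormedSpace.exp (s • A) *ᵥ x)) atTop (𝓝 v) := by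
  obtain ⟨S, f, hS, hN⟩ := aux_decomp A hreal x
  classical
  set S' := S.filter (fun l => f l ≠ 0) with hS'
  have hxS' : x = ∑ l ∈ S', f l := by
    rw [hS, hS', Finset.sum_filter_ne_zero]
  have hne : S'.Nonempty := by
    by_contra h
    rw [Finset.not_nonempty_iff_eq_empty] at h
    rw [h] at hxS'; exact hx (by simpa using hxS')
  set l := S'.max' hne with hl
  have hlS : l ∈ S' := Finset.max'_mem _ _
  have hfl : f l ≠ 0 := (Finset.mem_filter.1 hlS).2
  have hk : ∃ k, (A - l • (1 : Matrix (Fin n) (Fin n) ℝ)) ^ (k+1) *ᵥ f l = 0 ∧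
      (A - l • (1 : Matrix (Fin n) (Fin n) ℝ)) ^ k *ᵥ f l ≠ 0 := by
    have h0 : Nat.find (hN l) ≠ 0 := by
      intro h
      have := Nat.find_spec (hN l)
      rw [h] at this; simp at this; exact hfl this
    obtain ⟨k, hk⟩ := Nat.exists_eq_succ_of_ne_zero h0
    refine ⟨k, ?_, ?_⟩
    · have := Nat.find_spec (hN l)
      rwa [hk] at this
    · exact Nat.find_min (hN l) (by omega)
  obtain ⟨k, hk1, hk0⟩ := hk
  have hfac : ((k.factorial : ℝ)⁻¹) ≠ 0 := by positivity
  refine ⟨l, ((k.factorial : ℝ)⁻¹) • ((A - l • (1 : Matrix (Fin n) (Fin n) ℝ)) ^ k *ᵥ f l),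
    fun s => Real.exp (-(l * s)) * (s ^ k)⁻¹, smul_ne_zero hfac hk0, ?_, ?_⟩
  · rw [Matrix.mulVec_smul, smul_comm l]
    congr 1
    rw [pow_succ', ← Matrix.mulVec_mulVec, Matrix.sub_mulVec, Matrix.smul_mulVec,
      Matrix.one_mulVec, sub_eq_zero] at hk1
    exact hk1
  · have hinv : ∃ a : ℝ, Tendsto (fun s : ℝ => (s ^ k)⁻¹) atTop (𝓝 a) := by
      rcases Nat.eq_zero_or_pos k with h | h
      · subst h; exact ⟨1, by simp⟩
      · exact ⟨0, (tendsto_pow_atTop h.ne').inv_tendsto_atTop⟩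
    obtain ⟨a, ha⟩ := hinv
    have main : ∀ l' ∈ S', Tendsto (fun s : ℝ => (Real.exp (-(l * s)) * (s ^ k)⁻¹) •
        (NormedSpace.exp (s • A) *ᵥ f l')) atTop (𝓝 (if l' = l then ((k.factorial : ℝ)⁻¹) •
          ((A - l • (1 : Matrix (Fin n) (Fin n) ℝ)) ^ k *ᵥ f l) else 0)) := by
      intro l' hl'
      split_ifs with h
      · rw [h]
        have e : ∀ s : ℝ, (Real.exp (-(l * s)) * (s ^ k)⁻¹) •
          (NormedSpace.exp (s • A) *ᵥ f l) = ∑ j ∈ Finset.range (k+1),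
            (s ^ j * (s ^ k)⁻¹) • (((j.factorial : ℝ)⁻¹) •
              ((A - l • (1 : Matrix (Fin n) (Fin n) ℝ)) ^ j *ᵥ f l)) := by
          intro s
          rw [aux_exp_gen A l _ _ hk1, Finset.smul_sum]
          refine Finset.sum_congr rfl fun j _ => ?_
          rw [smul_smul, smul_smul]
          congr 1
          have : Real.exp (-(l * s)) * Real.exp (l * s) = 1 := by
            rw [← Real.exp_add]; simp
          linear_combination (s ^ k)⁻¹ * s ^ j * ((j.factorial : ℝ)⁻¹) * this
        simp_rw [e, Finset.sum_range_succ]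
        rw [← zero_add (((k.factorial : ℝ)⁻¹) • _)]
        refine Tendsto.add ?_ ?_
        · rw [← Finset.sum_const_zero (s := Finset.range k)]
          refine tendsto_finsetSum _ fun j hj => ?_
          rw [← zero_smul ℝ (((j.factorial : ℝ)⁻¹) •
              ((A - l • (1 : Matrix (Fin n) (Fin n) ℝ)) ^ j *ᵥ f l))]
          refine Tendsto.smul_const ?_ _
          have := tendsto_pow_div_pow_atTop_zero (𝕜 := ℝ) (Finset.mem_range.1 hj)
          simpa [div_eq_mul_inv] using this
        · refine tendsto_const_nhds.congr' ?_
          filter_upwards [eventually_gt_atTop 0] with s hs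
          rw [mul_inv_cancel₀ (by positivity), one_smul, zero_add]
      · have hlt : l' < l := lt_of_le_of_ne (Finset.le_max' _ _ hl') h
        obtain ⟨N, hN'⟩ := hN l'
        have e : ∀ s : ℝ, (Real.exp (-(l * s)) * (s ^ k)⁻¹) •
          (NormedSpace.exp (s • A) *ᵥ f l') = ∑ j ∈ Finset.range N,
            ((s ^ j / Real.exp ((l - l') * s)) * (s ^ k)⁻¹) • (((j.factorial : ℝ)⁻¹) •
              ((A - l' • (1 : Matrix (Fin n) (Fin n) ℝ)) ^ j *ᵥ f l')) := by
          intro s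
          rw [aux_exp_gen A l' _ _ hN', Finset.smul_sum]
          refine Finset.sum_congr rfl fun j _ => ?_
          rw [smul_smul, smul_smul]
          congr 1
          have : (Real.exp ((l - l') * s))⁻¹ = Real.exp (-(l * s)) * Real.exp (l' * s) := by
            rw [← Real.exp_add, ← Real.exp_neg]; congr 1; ring
          rw [div_eq_mul_inv, this]; ring
        simp_rw [e]
        rw [← Finset.sum_const_zero (s := Finset.range N)]
        refine tendsto_finsetSum _ fun j hj => ?_
        rw [← zero_smul ℝ (((j.factorial : ℝ)⁻¹) •
            ((A - l' • (1 : Matrix (Fin n) (Fin n) ℝ)) ^ j *ᵥ f l'))]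
        refine Tendsto.smul_const ?_ _
        have := (isLittleO_pow_exp_pos_mul_atTop j (sub_pos.2 hlt)).tendsto_div_nhds_zero.mul ha
        simpa using this
    have := tendsto_finsetSum S' main
    rw [Finset.sum_ite_eq' S' l, if_pos hlS] at this
    refine this.congr fun s => ?_
    rw [← Finset.smul_sum, ← Matrix.mulVec_sum, ← hxS']

noncomputable def qf {m : ℕ} (w u : Fin m → ℝ) : ℝ := u ⬝ᵥ u - (w ⬝ᵥ u) ^ 2

lemma qf_nonneg {m : ℕ} (w u : Fin m → ℝ) (hw : w ⬝ᵥ w = 1) : 0 ≤ qf w u := by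
  have h : 0 ≤ (u - (w ⬝ᵥ u) • w) ⬝ᵥ (u - (w ⬝ᵥ u) • w) := by
    simpa using dotProduct_star_self_nonneg (u - (w ⬝ᵥ u) • w)
  simp only [sub_dotProduct, dotProduct_sub, smul_dotProduct, dotProduct_smul, hw,
    dotProduct_comm u w, smul_eq_mul] at h
  unfold qf; nlinarith

lemma qf_le {m : ℕ} (w u : Fin m → ℝ) : qf w u ≤ u ⬝ᵥ u := by
  unfold qf; nlinarith [sq_nonneg (w ⬝ᵥ u)]

lemma qf_smul {m : ℕ} (w u : Fin m → ℝ) (c : ℝ) : qf w (c • u) = c ^ 2 * qf w u := by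
  unfold qf
  simp only [smul_dotProduct, dotProduct_smul, smul_eq_mul]; ring

lemma qf_half {m : ℕ} (w p a : Fin m → ℝ) (hw : w ⬝ᵥ w = 1) :
    qf w a / 2 - (p - a) ⬝ᵥ (p - a) ≤ qf w p := by
  have h1 := qf_nonneg w (p + (p - a)) hw
  have h2 := qf_le w (p - a)
  have h3 : qf w a = 2 * qf w p + 2 * qf w (p - a) - qf w (p + (p - a)) := by
    unfold qf
    simp only [dotProduct_sub, sub_dotProduct, dotProduct_add, add_dotProduct, dotProduct_comm a p]
    ring
  linarith

lemma qf_eq {m : ℕ} (w u : Fin m → ℝ) :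
    u ⬝ᵥ ((1 - vecMulVec w w) *ᵥ u) = qf w u := by
  rw [sub_mulVec, one_mulVec, dotProduct_sub, vecMulVec_mulVec]
  unfold qf
  simp [dotProduct_comm u w, sq]

noncomputable def gG {n m : ℕ} (A : Matrix (Fin n) (Fin n) ℝ) (C : Matrix (Fin m) (Fin n) ℝ)
    (y : ℝ → Fin m → ℝ) (t T : ℝ) (x : Fin n → ℝ) : ℝ :=
  ∫ σ in (0:ℝ)..T, qf (y (t + σ)) (C *ᵥ (NormedSpace.exp (σ • A) *ᵥ x))

lemma qf_cont {X : Type*} [TopologicalSpace X] {m : ℕ} {w u : X → Fin m → ℝ} (hw : Continuous w)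
    (hu : Continuous u) : Continuous fun s => qf (w s) (u s) := by
  unfold qf
  exact (hu.dotProduct hu).sub ((hw.dotProduct hu).pow 2)

section
variable {n m : ℕ} (A : Matrix (Fin n) (Fin n) ℝ) (C : Matrix (Fin m) (Fin n) ℝ)
    (y : ℝ → Fin m → ℝ) 

lemma F_cont (x : Fin n → ℝ) :
    Continuous fun σ : ℝ => C *ᵥ (NormedSpace.exp (σ • A) *ᵥ x) :=
  continuous_const.matrix_mulVec ((aux_exp_cont A).matrix_mulVec continuous_const)

lemma g_cont (hy : Continuous y) (t : ℝ) (x : Fin n → ℝ) :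
    Continuous fun σ : ℝ => qf (y (t + σ)) (C *ᵥ (NormedSpace.exp (σ • A) *ᵥ x)) :=
  qf_cont (hy.comp (continuous_const.add continuous_id)) (F_cont A C x)

lemma g_smul (t T c : ℝ) (x : Fin n → ℝ) : gG A C y t T (c • x) = c ^ 2 * gG A C y t T x := by
  unfold gG
  rw [← intervalIntegral.integral_const_mul]
  simp only [mulVec_smul, qf_smul]

lemma g_mono (hy : Continuous y) (hu : ∀ t, y t ⬝ᵥ y t = 1) (t T T' : ℝ) (h0 : 0 ≤ T)
    (h : T ≤ T') (x : Fin n → ℝ) : gG A C y t T x ≤ gG A C y t T' x := by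
  unfold gG
  refine intervalIntegral.integral_mono_interval le_rfl h0 h ?_
    ((g_cont A C y hy t x).intervalIntegrable _ _)
  exact Filter.Eventually.of_forall fun σ => qf_nonneg _ _ (hu _)

lemma g_shift (hy : Continuous y) (hu : ∀ t, y t ⬝ᵥ y t = 1) (t τ T : ℝ) (h0 : 0 ≤ τ)
    (hT : 0 ≤ T) (x : Fin n → ℝ) :
    gG A C y (t + τ) T (NormedSpace.exp (τ • A) *ᵥ x) ≤ gG A C y t (τ + T) x := by
  have e : gG A C y (t + τ) T (NormedSpace.exp (τ • A) *ᵥ x) =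
      ∫ σ in τ..(τ + T), qf (y (t + σ)) (C *ᵥ (NormedSpace.exp (σ • A) *ᵥ x)) := by
    have := intervalIntegral.integral_comp_add_left (a := 0) (b := T)
      (fun σ => qf (y (t + σ)) (C *ᵥ (NormedSpace.exp (σ • A) *ᵥ x))) τ
    rw [add_zero] at this
    rw [← this]
    unfold gG
    congr 1
    ext σ
    rw [mulVec_mulVec x, ← Matrix.exp_add_of_commute, ← add_smul, add_assoc, add_comm σ τ]
    exact ((Commute.refl A).smul_left _).smul_right _
  rw [e]
  unfold gG
  refine intervalIntegral.integral_mono_interval h0 (by linarith) le_rfl ?_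
    ((g_cont A C y hy t x).intervalIntegrable _ _)
  exact Filter.Eventually.of_forall fun σ => qf_nonneg _ _ (hu _)

def PP (x : Fin n → ℝ) : Prop :=
  ∃ T > (0:ℝ), ∃ μ > (0:ℝ), ∀ t, 0 ≤ t → μ ≤ gG A C y t T x

lemma g_open (hy : Continuous y) (hu : ∀ t, y t ⬝ᵥ y t = 1) (x : Fin n → ℝ) (T : ℝ) (hT : 0 < T)
    (μ : ℝ) (hμ : 0 < μ) (h : ∀ t, 0 ≤ t → μ ≤ gG A C y t T x) :
    ∀ᶠ x' in 𝓝 x, ∀ t, 0 ≤ t → μ / 4 ≤ gG A C y t T x' := by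
  have hη : 0 < μ / (4 * T) := by positivity
  have key : ∀ᶠ x' in 𝓝 x, ∀ σ ∈ Set.Icc 0 T,
      (C *ᵥ (NormedSpace.exp (σ • A) *ᵥ (x' - x))) ⬝ᵥ (C *ᵥ (NormedSpace.exp (σ • A) *ᵥ (x' - x)))
        < μ / (4 * T) := by
    refine isCompact_Icc.eventually_forall_of_forall_eventually fun σ _ => ?_
    have c1 : Continuous fun z : (Fin n → ℝ) × ℝ =>
        C *ᵥ (NormedSpace.exp (z.2 • A) *ᵥ (z.1 - x)) :=
      continuous_const.matrix_mulVec (((aux_exp_cont A).comp continuous_snd).matrix_mulVec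
        (continuous_fst.sub continuous_const))
    have c2 := c1.dotProduct c1
    refine c2.continuousAt.eventually_lt continuousAt_const ?_
    simpa using hη
  filter_upwards [key] with x' hx' t ht
  have hle : ∫ σ in (0:ℝ)..T, (qf (y (t + σ)) (C *ᵥ (NormedSpace.exp (σ • A) *ᵥ x)) / 2
      - μ / (4 * T)) ≤ gG A C y t T x' := by
    unfold gG
    refine intervalIntegral.integral_mono_on hT.le ?_
      ((g_cont A C y hy t x').intervalIntegrable _ _) fun σ hσ => ?_
    · exact (((g_cont A C y hy t x).div_const 2).sub continuous_const).intervalIntegrable _ _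
    · have h1 := qf_half (y (t + σ)) (C *ᵥ (NormedSpace.exp (σ • A) *ᵥ x'))
        (C *ᵥ (NormedSpace.exp (σ • A) *ᵥ x)) (hu _)
      have h2 := hx' σ hσ
      rw [mulVec_sub, mulVec_sub] at h2
      linarith
  rw [intervalIntegral.integral_sub
    (((g_cont A C y hy t x).div_const 2).intervalIntegrable _ _)
    (continuous_const.intervalIntegrable _ _), intervalIntegral.integral_div,
    intervalIntegral.integral_const] at hle
  have := h t ht
  unfold gG at this
  have e : (T - 0) • (μ / (4 * T)) = μ / 4 := by
    rw [smul_eq_mul]; field_simp; ring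
  rw [e] at hle
  linarith

lemma quad_matInt {ι : Type*} [Fintype ι] (f : ℝ → Matrix ι ι ℝ) (hf : Continuous f) (a b : ℝ)
    (x : ι → ℝ) : x ⬝ᵥ (matInt f a b *ᵥ x) = ∫ s in a..b, x ⬝ᵥ (f s *ᵥ x) := by
  have hc : ∀ i j, Continuous fun s => f s i j := fun i j => hf.matrix_elem i j
  simp only [dotProduct, mulVec, matInt, Matrix.of_apply]
  rw [intervalIntegral.integral_finsetSum]
  · refine Finset.sum_congr rfl fun i _ => ?_
    rw [intervalIntegral.integral_const_mul, intervalIntegral.integral_finsetSum]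
    · simp only [intervalIntegral.integral_mul_const]
    · intro j _
      exact ((hc i j).mul continuous_const).intervalIntegrable _ _
  · intro i _
    refine Continuous.intervalIntegrable ?_ _ _
    exact continuous_const.mul (continuous_finsetSum _ fun j _ => (hc i j).mul continuous_const)

lemma Pi_cont (hy : Continuous y) :
    Continuous fun s => (1 : Matrix (Fin m) (Fin m) ℝ) - vecMulVec (y s) (y s) :=
  continuous_const.sub (hy.matrix_vecMulVec hy)

lemma PP_eig (hy : Continuous y) (hu : ∀ t, y t ⬝ᵥ y t = 1)
    (δ ε : ℝ) (hδ : 0 < δ) (hε : 0 < ε)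
    (hpe : ∀ t, 0 ≤ t →
      ((1 / δ) • matInt (fun s => (1 : Matrix (Fin m) (Fin m) ℝ) - vecMulVec (y s) (y s))
          t (t + δ)
        - ε • (1 : Matrix (Fin m) (Fin m) ℝ)).PosSemidef)
    (l : ℝ) (v : Fin n → ℝ) (hv : A *ᵥ v = l • v) (hC : C *ᵥ v ≠ 0) : PP A C y v := by
  have hpos : 0 < (C *ᵥ v) ⬝ᵥ (C *ᵥ v) := by
    simpa using dotProduct_star_self_pos_iff.2 hC
  refine ⟨δ, hδ, Real.exp (-(|l| * δ)) ^ 2 * (δ * ε * ((C *ᵥ v) ⬝ᵥ (C *ᵥ v))), by positivity,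
    fun t ht => ?_⟩
  have h1 := (hpe t ht).dotProduct_mulVec_nonneg (C *ᵥ v)
  rw [star_trivial, sub_mulVec, dotProduct_sub, smul_mulVec, smul_mulVec, dotProduct_smul,
    dotProduct_smul, one_mulVec, quad_matInt _ (Pi_cont y hy)] at h1
  simp only [qf_eq, smul_eq_mul] at h1
  have h2 : δ * ε * ((C *ᵥ v) ⬝ᵥ (C *ᵥ v)) ≤ ∫ σ in (0:ℝ)..δ, qf (y (t + σ)) (C *ᵥ v) := by
    rw [intervalIntegral.integral_comp_add_left (fun s => qf (y s) (C *ᵥ v)), add_zero]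
    rw [sub_nonneg, one_div, ← div_eq_inv_mul, le_div_iff₀ hδ] at h1
    linarith
  have hvN : (A - l • (1 : Matrix (Fin n) (Fin n) ℝ)) ^ 1 *ᵥ v = 0 := by
    rw [pow_one, sub_mulVec, smul_mulVec, one_mulVec, hv, sub_self]
  have h3 : ∀ σ : ℝ, NormedSpace.exp (σ • A) *ᵥ v = Real.exp (l * σ) • v := by
    intro σ; rw [aux_exp_gen A l 1 v hvN]; simp
  calc _ ≤ Real.exp (-(|l| * δ)) ^ 2 * ∫ σ in (0:ℝ)..δ, qf (y (t + σ)) (C *ᵥ v) := by gcongr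
    _ = ∫ σ in (0:ℝ)..δ, Real.exp (-(|l| * δ)) ^ 2 * qf (y (t + σ)) (C *ᵥ v) := by
      rw [intervalIntegral.integral_const_mul]
    _ ≤ _ := by
      unfold gG
      refine intervalIntegral.integral_mono_on hδ.le ?_
        ((g_cont A C y hy t v).intervalIntegrable _ _) fun σ hσ => ?_
      · refine Continuous.intervalIntegrable (continuous_const.mul (qf_cont ?_ continuous_const)) _ _
        exact hy.comp (continuous_const.add continuous_id)
      · rw [h3, mulVec_smul, qf_smul]
        have := qf_nonneg (y (t + σ)) (C *ᵥ v) (hu _)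
        gcongr
        have a1 := neg_abs_le l
        have a2 := abs_nonneg l
        nlinarith [hσ.1, hσ.2]

lemma PP_all (hy : Continuous y) (hu : ∀ t, y t ⬝ᵥ y t = 1)
    (hreal : ∀ μ ∈ spectrum ℂ (A.map (algebraMap ℝ ℂ)), μ.im = 0)
    (heig : ∀ (l : ℝ) (v : Fin n → ℝ), v ≠ 0 → A *ᵥ v = l • v → PP A C y v) (x : Fin n → ℝ) (hx : x ≠ 0) :
    PP A C y x := by
  obtain ⟨l, v, c, hv, hl, hlim⟩ := aux_asymp A hreal x hx
  obtain ⟨T, hT, μ, hμ, h⟩ := heig l v hv hl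
  obtain ⟨s, hs, hs0⟩ := ((hlim.eventually (g_open A C y hy hu v T hT μ hμ h)).and
    (eventually_ge_atTop 0)).exists
  have hcs : c s ≠ 0 := by
    intro h0
    have := hs 0 le_rfl
    rw [g_smul, h0] at this
    simp at this; linarith
  have hc2 : 0 < c s ^ 2 := by positivity
  refine ⟨s + T, by linarith, μ / 4 / c s ^ 2, by positivity, fun t ht => ?_⟩
  refine le_trans ?_ (g_shift A C y hy hu t s T hs0 hT.le x)
  have := hs (t + s) (by linarith)
  rw [g_smul] at this
  rw [div_le_iff₀ hc2]; linarith

lemma PP_unif (hy : Continuous y) (hu : ∀ t, y t ⬝ᵥ y t = 1)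
    (hall : ∀ x : Fin n → ℝ, x ≠ 0 → PP A C y x) :
    ∃ T > (0:ℝ), ∃ μ > (0:ℝ), ∀ x : Fin n → ℝ, x ⬝ᵥ x = 1 → ∀ t, 0 ≤ t → μ ≤ gG A C y t T x := by
  have hcpt : IsCompact {x : Fin n → ℝ | x ⬝ᵥ x = 1} := by
    refine Metric.isCompact_of_isClosed_isBounded
      (isClosed_eq (continuous_id.dotProduct continuous_id) continuous_const) ?_
    refine (Metric.isBounded_closedBall (x := (0 : Fin n → ℝ)) (r := 1)).subset fun x hx => ?_
    rw [mem_closedBall_zero_iff, pi_norm_le_iff_of_nonneg zero_le_one]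
    intro i
    have h1 : x i * x i ≤ x ⬝ᵥ x :=
      Finset.single_le_sum (f := fun i => x i * x i) (fun j _ => mul_self_nonneg _)
        (Finset.mem_univ i)
    rw [Set.mem_setOf_eq] at hx
    rw [hx] at h1
    rw [Real.norm_eq_abs, abs_le]
    constructor <;> nlinarith
  refine hcpt.induction_on (p := fun s => ∃ T > (0:ℝ), ∃ μ > (0:ℝ), ∀ x ∈ s, ∀ t, 0 ≤ t →
    μ ≤ gG A C y t T x) ?_ ?_ ?_ ?_
  · exact ⟨1, one_pos, 1, one_pos, by simp⟩
  · rintro s s' hss ⟨T, hT, μ, hμ, h⟩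
    exact ⟨T, hT, μ, hμ, fun x hx => h x (hss hx)⟩
  · rintro s s' ⟨T, hT, μ, hμ, h⟩ ⟨T', hT', μ', hμ', h'⟩
    refine ⟨max T T', lt_max_of_lt_left hT, min μ μ', lt_min hμ hμ', ?_⟩
    rintro x (hx | hx) t ht
    · exact (min_le_left _ _).trans ((h x hx t ht).trans
        (g_mono A C y hy hu t _ _ hT.le (le_max_left _ _) x))
    · exact (min_le_right _ _).trans ((h' x hx t ht).trans
        (g_mono A C y hy hu t _ _ hT'.le (le_max_right _ _) x))
  · intro x hx
    have hx0 : x ≠ 0 := by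
      rintro rfl; simp at hx
    obtain ⟨T, hT, μ, hμ, h⟩ := hall x hx0
    exact ⟨_, mem_nhdsWithin_of_mem_nhds (g_open A C y hy hu x T hT μ hμ h), T, hT, μ / 4,
      by positivity, fun x' hx' => hx'⟩

lemma obs_eig 
    (hobs : (Matrix.of fun p : Fin n × Fin m => fun j : Fin n =>
      (C * A ^ (p.1 : ℕ)) p.2 j).rank = n) (l : ℝ) (v : Fin n → ℝ) (hv : v ≠ 0)
    (hl : A *ᵥ v = l • v) : C *ᵥ v ≠ 0 := by
  intro hC
  apply hv
  set M := (Matrix.of fun p : Fin n × Fin m => fun j : Fin n =>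
      (C * A ^ (p.1 : ℕ)) p.2 j) with hM
  have hp : ∀ k : ℕ, A ^ k *ᵥ v = l ^ k • v := by
    intro k
    induction k with
    | zero => simp
    | succ k ih => rw [pow_succ, ← mulVec_mulVec, hl, mulVec_smul, ih, smul_smul, pow_succ']
  have hMv : M *ᵥ v = 0 := by
    ext p
    have : (M *ᵥ v) p = ((C * A ^ (p.1 : ℕ)) *ᵥ v) p.2 := rfl
    rw [this, ← mulVec_mulVec, hp, mulVec_smul, hC]; simp
  have hk : LinearMap.ker M.mulVecLin = ⊥ := by
    have := LinearMap.finrank_range_add_finrank_ker M.mulVecLin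
    rw [Matrix.rank] at hobs
    rw [hobs] at this
    simp at this
    exact this
  have : v ∈ LinearMap.ker M.mulVecLin := by simpa using hMv
  rw [hk] at this
  simpa using this

end


/-- Lemma 5 of the paper: if `(A, C̄)` is Kalman observable, all eigenvalues of `A` are real,
and the projectors `I − y(t)y(t)ᵀ` are persistently exciting, then the Riccati observability
Grammian of `C(t) = Π_{y(t)} C̄` is uniformly positive definite. -/
theorem grammian_positive_of_pe_and_real_eigenvalues
    (n m : ℕ)
    (A : Matrix (Fin n) (Fin n) ℝ) (Cb : Matrix (Fin m) (Fin n) ℝ)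
    (hreal : ∀ μ ∈ spectrum ℂ (A.map (algebraMap ℝ ℂ)), μ.im = 0)
    (hobs : (Matrix.of fun p : Fin n × Fin m => fun j : Fin n =>
      (Cb * A ^ (p.1 : ℕ)) p.2 j).rank = n)
    (y : ℝ → Fin m → ℝ) (hycont : Continuous y) (hyunit : ∀ t, y t ⬝ᵥ y t = 1)
    (δ ε : ℝ) (hδ : 0 < δ) (hε : 0 < ε)
    (hpe : ∀ t, 0 ≤ t →
      ((1 / δ) • matInt (fun s => (1 : Matrix (Fin m) (Fin m) ℝ) - vecMulVec (y s) (y s))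
          t (t + δ)
        - ε • (1 : Matrix (Fin m) (Fin m) ℝ)).PosSemidef) :
    ∃ δ' > (0 : ℝ), ∃ μ > (0 : ℝ), ∀ t, 0 ≤ t →
      ((1 / δ') • matInt (fun s =>
          (NormedSpace.exp ((s - t) • A))ᵀ * Cbᵀ *
            ((1 : Matrix (Fin m) (Fin m) ℝ) - vecMulVec (y s) (y s)) * Cb *
            NormedSpace.exp ((s - t) • A)) t (t + δ')
        - μ • (1 : Matrix (Fin n) (Fin n) ℝ)).PosSemidef := by
  have heig : ∀ (l : ℝ) (v : Fin n → ℝ), v ≠ 0 → A *ᵥ v = l • v → PP A Cb y v := fun l v hv hl =>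
    PP_eig A Cb y hycont hyunit δ ε hδ hε hpe l v hl (obs_eig A Cb hobs l v hv hl)
  obtain ⟨T, hT, μ, hμ, h⟩ := PP_unif A Cb y hycont hyunit
    (PP_all A Cb y hycont hyunit hreal heig)
  refine ⟨T, hT, μ / T, by positivity, fun t ht => ?_⟩
  set f : ℝ → Matrix (Fin n) (Fin n) ℝ := fun s =>
          (NormedSpace.exp ((s - t) • A))ᵀ * Cbᵀ *
            ((1 : Matrix (Fin m) (Fin m) ℝ) - vecMulVec (y s) (y s)) * Cb *
            NormedSpace.exp ((s - t) • A) with hf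
  have hE : Continuous fun s : ℝ => NormedSpace.exp ((s - t) • A) :=
    (aux_exp_cont A).comp (continuous_id.sub continuous_const)
  have hfc : Continuous f :=
    (((hE.matrix_transpose.matrix_mul continuous_const).matrix_mul (Pi_cont y hycont)).matrix_mul
      continuous_const).matrix_mul hE
  have hsymm : ∀ s, (f s)ᵀ = f s := by
    intro s
    simp only [hf, transpose_mul, transpose_transpose, transpose_sub, transpose_one,
      transpose_vecMulVec, Matrix.mul_assoc]
  have hquad : ∀ x : Fin n → ℝ, x ⬝ᵥ (matInt f t (t + T) *ᵥ x) = gG A Cb y t T x := by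
    intro x
    rw [quad_matInt f hfc]
    unfold gG
    have := intervalIntegral.integral_comp_add_left (a := 0) (b := T) (fun s => x ⬝ᵥ (f s *ᵥ x)) t
    rw [add_zero] at this
    rw [← this]
    congr 1
    ext σ
    rw [← qf_eq]
    simp only [hf, add_sub_cancel_left, ← mulVec_mulVec]
    rw [dotProduct_mulVec, vecMul_transpose, dotProduct_mulVec, vecMul_transpose]
  refine PosSemidef.of_dotProduct_mulVec_nonneg ?_ fun x => ?_
  · ext i j
    have : ∀ s, f s j i = f s i j := fun s => congrFun (congrFun (hsymm s) i) j
    simp [conjTranspose_apply, matInt, this, Matrix.one_apply, eq_comm]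
  · rw [star_trivial, sub_mulVec, dotProduct_sub, smul_mulVec, smul_mulVec, dotProduct_smul,
      dotProduct_smul, one_mulVec, hquad, smul_eq_mul, smul_eq_mul]
    by_cases hx : x = 0
    · subst hx
      have := g_smul A Cb y t T 0 0
      simp at this
      simp [this]
    have hpos : 0 < x ⬝ᵥ x := by
      simpa using dotProduct_star_self_pos_iff.2 hx
    have hr : 0 < Real.sqrt (x ⬝ᵥ x) := Real.sqrt_pos.2 hpos
    have hr2 : Real.sqrt (x ⬝ᵥ x) ^ 2 = x ⬝ᵥ x := Real.sq_sqrt hpos.le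
    have h1 := h ((Real.sqrt (x ⬝ᵥ x))⁻¹ • x) (by
      rw [smul_dotProduct, dotProduct_smul, smul_eq_mul, smul_eq_mul, ← mul_assoc, ← sq, inv_pow,
        hr2, inv_mul_cancel₀ hpos.ne']) t ht
    rw [g_smul, inv_pow, hr2, ← div_eq_inv_mul, le_div_iff₀ hpos] at h1
    have : 1 / T * gG A Cb y t T x - μ / T * (x ⬝ᵥ x) =
      (gG A Cb y t T x - μ * (x ⬝ᵥ x)) / T := by ring
    rw [this]
    exact div_nonneg (by linarith) hT.le
end

section
/- Let A ∈ Matrix(n,n,ℝ) be a matrix all of whose complex eigenvalues are real, and let C̄ ∈ Matrix(m,n,ℝ) be such that the stacked Kalman observability matrix [C̄; C̄A; …; C̄A^{n−1}] has rank n. Then for every x̄ ∈ ℝⁿ with |x̄| = 1 there exist a natural number r ≥ 0, a real number λ, and a vector z ∈ ℝ^m with z ≠ 0, such that (t^r·e^{λt})⁻¹ · C̄·exp(At)·x̄ converges to z as t → +∞. -/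
open Matrix

namespace DomTerm

open Polynomial

/-- exponential-polynomial function -/
noncomputable def ep {E : Type*} [AddCommGroup E] [Module ℝ E]
    (w : (ℝ × ℕ) →₀ E) (t : ℝ) : E :=
  w.sum fun p v => (t ^ p.2 * Real.exp (p.1 * t)) • v

lemma ep_add {E : Type*} [AddCommGroup E] [Module ℝ E]
    (w w' : (ℝ × ℕ) →₀ E) (t : ℝ) : ep (w + w') t = ep w t + ep w' t := by
  unfold ep
  exact Finsupp.sum_add_index' (by simp) (by simp)

lemma ep_sum {E : Type*} [AddCommGroup E] [Module ℝ E] {ι : Type*} (s : Finset ι)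
    (w : ι → (ℝ × ℕ) →₀ E) (t : ℝ) : ep (∑ i ∈ s, w i) t = ∑ i ∈ s, ep (w i) t := by
  classical
  induction s using Finset.induction_on with
  | empty => simp [ep]
  | insert a s ha ih => rw [Finset.sum_insert ha, Finset.sum_insert ha, ep_add, ih]

lemma ep_single {E : Type*} [AddCommGroup E] [Module ℝ E] (p : ℝ × ℕ) (v : E) (t : ℝ) :
    ep (Finsupp.single p v) t = (t ^ p.2 * Real.exp (p.1 * t)) • v := by
  simp [ep]

lemma scalar_lim (a b : ℝ) (j k : ℕ) (h : a < b ∨ (a = b ∧ j < k)) :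
    Filter.Tendsto (fun t : ℝ => (t ^ k * Real.exp (b * t))⁻¹ * (t ^ j * Real.exp (a * t)))
      Filter.atTop (nhds 0) := by
  rcases h with h | ⟨rfl, h⟩
  · have h1 : Filter.Tendsto (fun t : ℝ => t ^ j * Real.exp (-((b - a) * t))) Filter.atTop
        (nhds 0) := by
      have := Real.tendsto_pow_mul_exp_neg_atTop_nhds_zero j
      have h2 := this.comp (Filter.tendsto_id.const_mul_atTop (sub_pos.2 h))
      have h3 := h2.const_mul (((b - a) ^ j)⁻¹)
      rw [mul_zero] at h3
      refine h3.congr fun t => ?_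
      have : (b - a) ^ j ≠ 0 := pow_ne_zero _ (sub_pos.2 h).ne'
      simp only [Function.comp, id, mul_pow]
      field_simp
    refine squeeze_zero_norm' ?_ h1
    filter_upwards [Filter.eventually_ge_atTop 1] with t ht
    have ht0 : 0 < t := by linarith
    have hk : 1 ≤ t ^ k := one_le_pow₀ ht
    rw [Real.norm_of_nonneg (by positivity)]
    have : Real.exp (-((b - a) * t)) = (Real.exp (b * t))⁻¹ * Real.exp (a * t) := by
      rw [← Real.exp_neg, ← Real.exp_add]; ring_nf
    rw [this, mul_inv]
    have h4 : (t ^ k)⁻¹ ≤ 1 := inv_le_one_of_one_le₀ hk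
    calc (t ^ k)⁻¹ * (Real.exp (b * t))⁻¹ * (t ^ j * Real.exp (a * t))
        = (t ^ k)⁻¹ * (t ^ j * ((Real.exp (b * t))⁻¹ * Real.exp (a * t))) := by ring
      _ ≤ 1 * (t ^ j * ((Real.exp (b * t))⁻¹ * Real.exp (a * t))) := by gcongr
      _ = _ := one_mul _
  · have h1 : Filter.Tendsto (fun t : ℝ => t⁻¹ ^ (k - j)) Filter.atTop (nhds 0) := by
      have := (tendsto_inv_atTop_zero (𝕜 := ℝ)).pow (k - j)
      rwa [zero_pow (by omega)] at this
    refine h1.congr' ?_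
    filter_upwards [Filter.eventually_gt_atTop 0] with t ht
    obtain ⟨d, rfl⟩ := Nat.exists_eq_add_of_lt h
    have : j + d + 1 - j = d + 1 := by omega
    rw [this, show j + d + 1 = j + (d + 1) by ring, pow_add t j, inv_pow]
    have := (Real.exp_pos (a * t)).ne'
    have := ht.ne'
    field_simp

lemma ep_lim {E : Type*} [NormedAddCommGroup E] [NormedSpace ℝ E]
    (w : (ℝ × ℕ) →₀ E) (hw : w ≠ 0) :
    ∃ (r : ℕ) (l : ℝ) (z : E), z ≠ 0 ∧
      Filter.Tendsto (fun t : ℝ => (t ^ r * Real.exp (l * t))⁻¹ • ep w t) Filter.atTop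
        (nhds z) := by
  classical
  obtain ⟨q, hq, hmax⟩ := Finset.exists_max_image w.support (fun p => toLex p)
    (Finsupp.support_nonempty_iff.2 hw)
  refine ⟨q.2, q.1, w q, Finsupp.mem_support_iff.1 hq, ?_⟩
  have key : Filter.Tendsto (fun t : ℝ => ∑ p ∈ w.support,
      ((t ^ q.2 * Real.exp (q.1 * t))⁻¹ * (t ^ p.2 * Real.exp (p.1 * t))) • w p) Filter.atTop
      (nhds (∑ p ∈ w.support, (if p = q then (1 : ℝ) else 0) • w p)) := by
    refine tendsto_finsetSum _ fun p hp => ?_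
    refine Filter.Tendsto.smul_const ?_ _
    split_ifs with h
    · subst h
      refine tendsto_const_nhds.congr' ?_
      filter_upwards [Filter.eventually_gt_atTop 0] with t ht
      rw [inv_mul_cancel₀]
      positivity
    · apply scalar_lim
      have := lt_of_le_of_ne (hmax p hp) (fun hh => h (toLex.injective hh))
      simpa [Prod.Lex.toLex_lt_toLex] using this
  have e : (∑ p ∈ w.support, (if p = q then (1 : ℝ) else 0) • w p) = w q := by
    rw [Finset.sum_eq_single q (by intro b _ hb; simp [hb]) (fun h => absurd hq h)]; simp
  rw [e] at key
  refine key.congr fun t => ?_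
  simp only [ep, Finsupp.sum, Finset.smul_sum, smul_smul]

section mat
attribute [local instance] Matrix.linftyOpNormedRing Matrix.linftyOpNormedAlgebra

variable {n : ℕ} (A : Matrix (Fin n) (Fin n) ℝ)

lemma exp_gen (μ : ℝ) (k : ℕ) (x : Fin n → ℝ)
    (hx : ((A - μ • 1) ^ k) *ᵥ x = 0) :
    ∃ w : (ℝ × ℕ) →₀ (Fin n → ℝ), ∀ t : ℝ, NormedSpace.exp (t • A) *ᵥ x = ep w t := by
  set N := A - μ • (1 : Matrix (Fin n) (Fin n) ℝ) with hN
  refine ⟨∑ i ∈ Finset.range k,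
    Finsupp.single (μ, i) (((i.factorial : ℝ)⁻¹) • (N ^ i *ᵥ x)), fun t => ?_⟩
  have h1 : t • A = (μ * t) • (1 : Matrix (Fin n) (Fin n) ℝ) + t • N := by
    rw [hN, smul_sub, smul_smul, mul_comm]; abel
  have hz : ∀ i, k ≤ i → N ^ i *ᵥ x = 0 := by
    intro i hi
    obtain ⟨d, rfl⟩ := Nat.exists_eq_add_of_le hi
    rw [add_comm, pow_add, ← Matrix.mulVec_mulVec, hx, Matrix.mulVec_zero]
  have h2 : NormedSpace.exp ((μ * t) • (1 : Matrix (Fin n) (Fin n) ℝ))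
      = Real.exp (μ * t) • 1 := by
    have := NormedSpace.algebraMap_exp_comm (𝕂 := ℝ) (𝔸 := Matrix (Fin n) (Fin n) ℝ) (μ * t)
    rw [Algebra.algebraMap_eq_smul_one, Algebra.algebraMap_eq_smul_one] at this
    rw [Real.exp_eq_exp_ℝ]
    exact this.symm
  have h3 : NormedSpace.exp (t • N) *ᵥ x
      = ∑ i ∈ Finset.range k, (t ^ i) • (((i.factorial : ℝ)⁻¹) • (N ^ i *ᵥ x)) := by
    have hs := NormedSpace.exp_series_hasSum_exp' (𝕂 := ℝ) (t • N)
    let L : Matrix (Fin n) (Fin n) ℝ →ₗ[ℝ] (Fin n → ℝ) :=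
      { toFun := fun M => M *ᵥ x
        map_add' := fun a b => Matrix.add_mulVec a b x
        map_smul' := fun c a => Matrix.smul_mulVec c a x }
    have hL : Continuous L := L.continuous_of_finiteDimensional
    have hs2 := hs.map L hL
    have hs3 : HasSum (L ∘ fun i => ((i.factorial : ℝ)⁻¹) • (t • N) ^ i)
      (∑ i ∈ Finset.range k, (L ∘ fun i => ((i.factorial : ℝ)⁻¹) • (t • N) ^ i) i) := by
      apply hasSum_sum_of_ne_finset_zero
      intro i hi
      simp only [Finset.mem_range, not_lt] at hi
      simp [L, _root_.smul_pow, Matrix.smul_mulVec, hz i hi]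
    have := hs2.unique hs3
    refine Eq.trans this ?_
    refine Finset.sum_congr rfl fun i _ => ?_
    simp only [L, Function.comp, LinearMap.coe_mk, AddHom.coe_mk, _root_.smul_pow, Matrix.smul_mulVec]
    rw [smul_comm]
  have hc : Commute ((μ * t) • (1 : Matrix (Fin n) (Fin n) ℝ)) (t • N) :=
    ((Commute.one_left N).smul_left _).smul_right _
  rw [h1, Matrix.exp_add_of_commute _ _ hc, h2, ep_sum, ← Matrix.mulVec_mulVec, h3,
    Matrix.smul_mulVec, Matrix.one_mulVec, Finset.smul_sum]
  refine Finset.sum_congr rfl fun i _ => ?_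
  rw [ep_single, smul_smul, mul_comm]

lemma exp_prod (S : Finset ℝ) (k : ℝ → ℕ) : ∀ (x : Fin n → ℝ)
    (_ : (aeval (Matrix.toLin' A) (∏ μ ∈ S, (X - C μ) ^ k μ)) x = 0),
    ∃ w : (ℝ × ℕ) →₀ (Fin n → ℝ), ∀ t : ℝ, NormedSpace.exp (t • A) *ᵥ x = ep w t := by
  classical
  induction S using Finset.induction_on with
  | empty =>
    intro x hx
    simp at hx
    exact ⟨0, fun t => by simp [hx, ep]⟩
  | insert a S ha ih =>
    intro x hx
    rw [Finset.prod_insert ha] at hx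
    have hcop : IsCoprime ((X - C a : ℝ[X]) ^ k a) (∏ μ ∈ S, (X - C μ) ^ k μ) := by
      apply IsCoprime.prod_right
      intro μ hμ
      apply IsCoprime.pow
      apply Polynomial.isCoprime_X_sub_C_of_isUnit_sub
      rw [isUnit_iff_ne_zero, sub_ne_zero]
      rintro rfl
      exact ha hμ
    have hm : x ∈ LinearMap.ker (aeval (Matrix.toLin' A)
      ((X - C a : ℝ[X]) ^ k a * ∏ μ ∈ S, (X - C μ) ^ k μ)) := hx
    rw [← Polynomial.sup_ker_aeval_eq_ker_aeval_mul_of_coprime _ hcop,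
      Submodule.mem_sup] at hm
    obtain ⟨y, hy, z, hz, rfl⟩ := hm
    obtain ⟨w2, hw2⟩ := ih z hz
    obtain ⟨w1, hw1⟩ := exp_gen A a (k a) y (by
      have : aeval (Matrix.toLin' A) ((X - C a : ℝ[X]) ^ k a)
          = Matrix.toLin' ((A - a • 1) ^ k a) := by
        rw [Matrix.toLin'_pow]
        simp [Algebra.algebraMap_eq_smul_one, Module.End.one_eq_id]
      rw [LinearMap.mem_ker, this, Matrix.toLin'_apply] at hy
      exact hy)
    exact ⟨w1 + w2, fun t => by rw [Matrix.mulVec_add, hw1, hw2, ep_add]⟩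

lemma exp_all (hreal : ∀ μ ∈ spectrum ℂ (A.map (algebraMap ℝ ℂ)), μ.im = 0) (x : Fin n → ℝ) :
    ∃ w : (ℝ × ℕ) →₀ (Fin n → ℝ), ∀ t : ℝ, NormedSpace.exp (t • A) *ᵥ x = ep w t := by
  classical
  have hs : A.charpoly.Splits := by
    apply Polynomial.Splits.of_splits_map (algebraMap ℝ ℂ) (IsAlgClosed.splits _)
    intro a ha
    rw [← Matrix.charpoly_map, Polynomial.mem_roots
      (Matrix.charpoly_monic _).ne_zero, ← Matrix.mem_spectrum_iff_isRoot_charpoly] at ha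
    exact ⟨a.re, Complex.ext (by simp) (by simp [hreal a ha])⟩
  have hp := hs.eq_prod_roots_of_monic (Matrix.charpoly_monic A)
  rw [Finset.prod_multiset_map_count] at hp
  apply exp_prod A A.charpoly.roots.toFinset (fun μ => A.charpoly.roots.count μ)
  rw [← hp, ← Matrix.charpoly_toLin', LinearMap.aeval_self_charpoly]
  rfl

lemma all_zero {m : ℕ} (Cb : Matrix (Fin m) (Fin n) ℝ) (x : Fin n → ℝ)
    (h : ∀ t : ℝ, (Cb * NormedSpace.exp (t • A)) *ᵥ x = 0) (k : ℕ) :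
    ∀ t : ℝ, (Cb * A ^ k * NormedSpace.exp (t • A)) *ᵥ x = 0 := by
  induction k with
  | zero => simpa using h
  | succ k ih =>
    intro t
    let L : Matrix (Fin n) (Fin n) ℝ →ₗ[ℝ] (Fin m → ℝ) :=
      { toFun := fun M => (Cb * A ^ k * M) *ᵥ x
        map_add' := fun a b => by rw [Matrix.mul_add, Matrix.add_mulVec]
        map_smul' := fun c a => by rw [Matrix.mul_smul, Matrix.smul_mulVec]; rfl }
    have hd := hasDerivAt_exp_smul_const' (𝕂 := ℝ) A t
    have hd2 := (LinearMap.toContinuousLinearMap L).hasFDerivAt.comp_hasDerivAt t hd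
    have hd3 : HasDerivAt (fun _ : ℝ => (0 : Fin m → ℝ)) (L (A * NormedSpace.exp (t • A))) t :=
      hd2.congr_of_eventuallyEq (Filter.Eventually.of_forall fun u => (ih u).symm)
    have := hd3.unique (hasDerivAt_const t 0)
    change (Cb * A ^ k * (A * _)) *ᵥ x = 0 at this
    rwa [pow_succ, ← Matrix.mul_assoc, Matrix.mul_assoc (Cb * A ^ k)]

end mat

end DomTerm

/-- Technical lemma: for a matrix `A` with all eigenvalues real and an observable pair
`(A, C̄)`, for every unit vector `x̄` the curve `C̄ exp(At) x̄`, normalized by a suitable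
`t^r e^{λt}`, converges to a nonzero vector `z` as `t → ∞`. -/
theorem dominant_term_of_observable_real_eigenvalues
    (n m : ℕ)
    (A : Matrix (Fin n) (Fin n) ℝ) (Cb : Matrix (Fin m) (Fin n) ℝ)
    (hreal : ∀ μ ∈ spectrum ℂ (A.map (algebraMap ℝ ℂ)), μ.im = 0)
    (hobs : (Matrix.of fun p : Fin n × Fin m => fun j : Fin n =>
      (Cb * A ^ (p.1 : ℕ)) p.2 j).rank = n)
    (xb : Fin n → ℝ) (hxb : xb ⬝ᵥ xb = 1) :
    ∃ (r : ℕ) (l : ℝ) (z : Fin m → ℝ), z ≠ 0 ∧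
      Filter.Tendsto
        (fun t : ℝ => (t ^ r * Real.exp (l * t))⁻¹ • ((Cb * NormedSpace.exp (t • A)) *ᵥ xb))
        Filter.atTop (nhds z) := by
  obtain ⟨w, hw⟩ := DomTerm.exp_all A hreal xb
  let w' : (ℝ × ℕ) →₀ (Fin m → ℝ) := w.mapRange (fun v => Cb *ᵥ v) (Matrix.mulVec_zero _)
  have hw' : ∀ t : ℝ, (Cb * NormedSpace.exp (t • A)) *ᵥ xb = DomTerm.ep w' t := by
    intro t
    rw [← Matrix.mulVec_mulVec, hw]
    unfold DomTerm.ep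
    rw [Finsupp.sum_mapRange_index (by simp)]
    simp only [Finsupp.sum]
    change Cb.mulVecLin _ = _
    rw [map_sum]
    simp [Matrix.mulVec_smul]
  have hne : w' ≠ 0 := by
    intro h0
    have hz : ∀ t : ℝ, (Cb * NormedSpace.exp (t • A)) *ᵥ xb = 0 := by
      intro t; rw [hw', h0]; simp [DomTerm.ep]
    have hk : ∀ k : ℕ, (Cb * A ^ k) *ᵥ xb = 0 := by
      intro k
      simpa using DomTerm.all_zero A Cb xb hz k 0
    set O := (Matrix.of fun p : Fin n × Fin m => fun j : Fin n =>
      (Cb * A ^ (p.1 : ℕ)) p.2 j) with hO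
    have hOx : O.mulVecLin xb = 0 := by
      funext p
      exact congrFun (hk p.1) p.2
    have hrn := O.mulVecLin.finrank_range_add_finrank_ker
    have hr : Module.finrank ℝ (LinearMap.range O.mulVecLin) = n := hobs
    rw [hr, Module.finrank_fin_fun] at hrn
    have hker : LinearMap.ker O.mulVecLin = ⊥ := Submodule.finrank_eq_zero.1 (by omega)
    have hx0 : xb = 0 := by
      have : xb ∈ LinearMap.ker O.mulVecLin := hOx
      rwa [hker, Submodule.mem_bot] at this
    simp [hx0] at hxb
  simp_rw [hw']
  exact DomTerm.ep_lim w' hne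
end

section
/- Let A = [[0, 1], [−1, 0]] ∈ Matrix(2,2,ℝ), y(t) := (cos t, −sin t)ᵀ, and Π_{y(t)} := I₂ − y(t)y(t)ᵀ. Then: (i) ∫_t^{t+2π} Π_{y(s)} ds = π·I₂ for every t, so the persistent excitation condition (1/δ)∫_t^{t+δ} Π_{y(s)} ds ≥ ε·I holds with δ = 2π and ε = 1/2; (ii) with b := (1, 0)ᵀ one has exp(As)·b = y(s) and hence Π_{y(s)}·exp(As)·b = 0 for all s ∈ ℝ; consequently, for every t ∈ ℝ and every δ > 0, the nonzero vector v_t := exp(At)·b satisfies v_tᵀ · (∫_t^{t+δ} exp(A(s−t))ᵀ Π_{y(s)} exp(A(s−t)) ds) · v_t = 0, so this observability Grammian is singular for every t and δ. -/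
open Matrix MeasureTheory

lemma exp_rot (s : ℝ) : NormedSpace.exp (s • (!![0, 1; -1, 0] : Matrix (Fin 2) (Fin 2) ℝ)) =
    !![Real.cos s, Real.sin s; -Real.sin s, Real.cos s] := by
  have hA : (!![0, 1; -1, 0] : Matrix (Fin 2) (Fin 2) ℝ) * !![0, 1; -1, 0] = -1 := by
    ext i j; fin_cases i <;> fin_cases j <;> simp [Matrix.mul_apply, Fin.sum_univ_two]
  let f : ℂ →ₐ[ℝ] Matrix (Fin 2) (Fin 2) ℝ := Complex.liftAux _ hA
  have hf : Continuous f := f.toLinearMap.continuous_of_finiteDimensional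
  have h1 : f (s * Complex.I) = s • (!![0, 1; -1, 0] : Matrix (Fin 2) (Fin 2) ℝ) := by
    simp [f, Complex.liftAux_apply]
  letI : NormedRing (Matrix (Fin 2) (Fin 2) ℝ) := Matrix.linftyOpNormedRing
  letI : NormedAlgebra ℝ (Matrix (Fin 2) (Fin 2) ℝ) := Matrix.linftyOpNormedAlgebra
  have h2 := NormedSpace.map_exp f hf (s * Complex.I)
  rw [← h1]
  refine Eq.trans h2.symm ?_
  rw [← Complex.exp_eq_exp_ℂ, Complex.exp_mul_I]
  simp only [f, Complex.liftAux_apply]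
  ext i j
  fin_cases i <;> fin_cases j <;>
    simp [Complex.cos_ofReal_re, Complex.sin_ofReal_re, Matrix.algebraMap_matrix_apply]

/-- Counterexample with complex eigenvalues: for `A = [[0,1],[−1,0]]` and
`y(t) = (cos t, −sin t)ᵀ`, persistent excitation holds (`∫_t^{t+2π} Π_{y(s)} ds = π I`,
so the p.e. condition holds with `δ = 2π`, `ε = 1/2`), yet with `b = (1,0)ᵀ` one has
`exp(As) b = y(s)`, `Π_{y(s)} exp(As) b = 0`, so the observability Grammian is singular
for every `t` and `δ`. -/
theorem complex_eigenvalues_counterexample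
    (A : Matrix (Fin 2) (Fin 2) ℝ) (hA : A = !![0, 1; -1, 0])
    (y : ℝ → Fin 2 → ℝ) (hy : y = fun t => ![Real.cos t, -Real.sin t])
    (Pr : ℝ → Matrix (Fin 2) (Fin 2) ℝ)
    (hPr : Pr = fun t => (1 : Matrix (Fin 2) (Fin 2) ℝ) - vecMulVec (y t) (y t))
    (b : Fin 2 → ℝ) (hb : b = ![1, 0]) :
    (∀ t : ℝ, matInt Pr t (t + 2 * Real.pi) = Real.pi • (1 : Matrix (Fin 2) (Fin 2) ℝ)) ∧
    (∀ t : ℝ,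
      ((1 / (2 * Real.pi)) • matInt Pr t (t + 2 * Real.pi)
        - (1 / 2 : ℝ) • (1 : Matrix (Fin 2) (Fin 2) ℝ)).PosSemidef) ∧
    (∀ s : ℝ, NormedSpace.exp (s • A) *ᵥ b = y s) ∧
    (∀ s : ℝ, Pr s *ᵥ (NormedSpace.exp (s • A) *ᵥ b) = 0) ∧
    (∀ t δ : ℝ, 0 < δ →
      NormedSpace.exp (t • A) *ᵥ b ≠ 0 ∧
      (NormedSpace.exp (t • A) *ᵥ b) ⬝ᵥ
        ((matInt (fun s => (NormedSpace.exp ((s - t) • A))ᵀ * Pr s *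
            NormedSpace.exp ((s - t) • A)) t (t + δ)) *ᵥ
          (NormedSpace.exp (t • A) *ᵥ b)) = 0) := by
  subst hA hb hPr hy
  have h1 : ∀ t : ℝ, matInt (fun t => (1 : Matrix (Fin 2) (Fin 2) ℝ) -
      vecMulVec ((fun t => ![Real.cos t, -Real.sin t]) t)
        ((fun t => ![Real.cos t, -Real.sin t]) t)) t (t + 2 * Real.pi)
      = Real.pi • (1 : Matrix (Fin 2) (Fin 2) ℝ) := by
    intro t
    have e1 : ∀ s, 1 - Real.cos s * Real.cos s = Real.sin s ^ 2 := fun s => by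
      nlinarith [Real.sin_sq_add_cos_sq s]
    have e2 : ∀ s, 1 - Real.sin s * Real.sin s = Real.cos s ^ 2 := fun s => by
      nlinarith [Real.sin_sq_add_cos_sq s]
    have e3 : ∀ s, Real.cos s * Real.sin s = Real.sin s * Real.cos s := fun s => mul_comm _ _
    ext i j
    fin_cases i <;> fin_cases j <;>
      simp [matInt, vecMulVec_apply, e1, e2, e3, integral_sin_sq, integral_cos_sq,
        integral_sin_mul_cos₁]
  refine ⟨h1, ?_, ?_, ?_, ?_⟩
  · intro t
    rw [h1 t, smul_smul]
    have : 1 / (2 * Real.pi) * Real.pi = 1 / 2 := by field_simp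
    rw [this, sub_self]
    exact Matrix.PosSemidef.zero
  · intro s
    rw [exp_rot]
    ext i; fin_cases i <;> simp [Matrix.mulVec, dotProduct]
  · intro s
    rw [exp_rot]
    have := Real.sin_sq_add_cos_sq s
    ext i; fin_cases i <;> simp [Matrix.mulVec, dotProduct, vecMulVec_apply]
    · linear_combination -Real.cos s * this
    · linear_combination Real.sin s * this
  · intro t δ _
    have hv : NormedSpace.exp (t • (!![0, 1; -1, 0] : Matrix (Fin 2) (Fin 2) ℝ)) *ᵥ ![1, 0] =
        ![Real.cos t, -Real.sin t] := by
      rw [exp_rot]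
      ext i; fin_cases i <;> simp [Matrix.mulVec, dotProduct]
    rw [hv]
    constructor
    · intro h
      have a := congrFun h 0
      have c := congrFun h 1
      simp at a c
      have := Real.sin_sq_add_cos_sq t
      simp [a, c] at this
    · have key : (fun s : ℝ =>
          (NormedSpace.exp ((s - t) • (!![0, 1; -1, 0] : Matrix (Fin 2) (Fin 2) ℝ)))ᵀ *
          ((fun t => (1 : Matrix (Fin 2) (Fin 2) ℝ) -
      vecMulVec ((fun t => ![Real.cos t, -Real.sin t]) t)
        ((fun t => ![Real.cos t, -Real.sin t]) t)) s) *
          NormedSpace.exp ((s - t) • (!![0, 1; -1, 0] : Matrix (Fin 2) (Fin 2) ℝ))) =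
          fun _ => vecMulVec ![Real.sin t, Real.cos t] ![Real.sin t, Real.cos t] := by
        funext s
        have ez : (1 : Matrix (Fin 2) (Fin 2) ℝ) -
            vecMulVec ![Real.cos s, -Real.sin s] ![Real.cos s, -Real.sin s] =
            vecMulVec ![Real.sin s, Real.cos s] ![Real.sin s, Real.cos s] := by
          have := Real.sin_sq_add_cos_sq s
          ext i j
          fin_cases i <;> fin_cases j <;> simp [vecMulVec_apply] <;> linarith
        have es : Real.sin t = Real.sin (s - (s - t)) := by congr 1; ring
        have ec : Real.cos t = Real.cos (s - (s - t)) := by congr 1; ring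
        rw [Real.sin_sub] at es
        rw [Real.cos_sub] at ec
        simp only [ez, exp_rot]
        rw [es, ec]
        ext i j
        fin_cases i <;> fin_cases j <;>
          simp [Matrix.mul_apply, Fin.sum_univ_two, vecMulVec_apply] <;> ring
      rw [key]
      simp [matInt, Matrix.mulVec, dotProduct, Fin.sum_univ_two, vecMulVec_apply]
      ring
end

section
/- Let u : ℝ → ℝⁿ be bounded and twice continuously differentiable with bounded first derivative u̇ and bounded second derivative ü, and suppose there exist δ > 0 and μ > 0 such that (1/δ)∫_t^{t+δ} u̇(s)u̇(s)ᵀ ds ≥ μ·I for all t ≥ 0. Then there exists μ̄ > 0 such that for all t ≥ 0 and all (b₁, b₂, c₁, c₂, c₃) ∈ ℝⁿ × ℝⁿ × ℝ × ℝ × ℝ with |b₁|² + |b₂|² + c₁² + c₂² + c₃² = 1, one has (1/δ)∫_t^{t+δ} [ c₁² + (u(s)ᵀb₁ + c₂)² + (u̇(s)ᵀb₁ + 2·u(s)ᵀb₂ + c₃)² ] ds ≥ μ̄. -/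
open Matrix MeasureTheory

lemma aux_sup (L δ : ℝ) (hL : 0 ≤ L) (hδ : 0 < δ) (ε : ℝ) (hε : 0 < ε) :
    ∃ η > (0:ℝ), ∀ (t : ℝ) (f : ℝ → ℝ), Continuous f →
      (∀ x y, |f x - f y| ≤ L * |x - y|) →
      (∫ s in t..(t+δ), (f s)^2) ≤ η → ∀ s ∈ Set.Icc t (t+δ), |f s| ≤ ε := by
  obtain ⟨r, hr0, hr1, hr2⟩ : ∃ r > 0, r ≤ δ/2 ∧ L * r ≤ ε/2 := by
    refine ⟨min (δ/2) (ε/(2*(L+1))), by positivity, min_le_left _ _, ?_⟩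
    have h1 : min (δ/2) (ε/(2*(L+1))) ≤ ε/(2*(L+1)) := min_le_right _ _
    have h2 : L * (ε/(2*(L+1))) ≤ ε/2 := by
      rw [mul_div_assoc', div_le_div_iff₀ (by positivity) (by positivity)]
      nlinarith
    exact (mul_le_mul_of_nonneg_left h1 hL).trans h2
  refine ⟨r * (ε/2)^2 / 2, by positivity, ?_⟩
  intro t f hf hlip hint s hs
  by_contra! hcon
  obtain ⟨a, ha1, ha2, ha3⟩ : ∃ a, t ≤ a ∧ a + r ≤ t + δ ∧ ∀ x ∈ Set.Icc a (a+r), |s - x| ≤ r := by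
    rcases le_total s (t + δ/2) with h | h
    · refine ⟨s, hs.1, by linarith, fun x hx => ?_⟩
      rw [abs_le]; constructor <;> linarith [hx.1, hx.2]
    · refine ⟨s - r, by linarith, by linarith [hs.2], fun x hx => ?_⟩
      rw [abs_le]; constructor <;> linarith [hx.1, hx.2]
  have h1 : (∫ x in a..(a+r), (ε/2)^2) ≤ ∫ x in a..(a+r), (f x)^2 := by
    apply intervalIntegral.integral_mono_on (by linarith)
    · exact (continuous_const).intervalIntegrable _ _
    · exact (hf.pow 2).intervalIntegrable _ _
    · intro x hx
      have h2 := hlip s x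
      have h3 := mul_le_mul_of_nonneg_left (ha3 x hx) hL
      have h4 := abs_sub_abs_le_abs_sub (f s) (f x)
      have h5 : ε/2 ≤ |f x| := by linarith
      rw [← sq_abs (f x)]
      exact pow_le_pow_left₀ (by positivity) h5 2
  have h2 : (∫ x in a..(a+r), (f x)^2) ≤ ∫ x in t..(t+δ), (f x)^2 := by
    apply intervalIntegral.integral_mono_interval ha1 (by linarith) ha2
    · exact Filter.Eventually.of_forall fun x => sq_nonneg _
    · exact (hf.pow 2).intervalIntegrable _ _
  rw [intervalIntegral.integral_const] at h1
  simp only [add_sub_cancel_left, smul_eq_mul] at h1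
  have : 0 < r * (ε/2)^2 := by positivity
  linarith

lemma aux_deriv (L K δ : ℝ) (hL : 0 ≤ L) (hK : 0 ≤ K) (hδ : 0 < δ) (ε : ℝ) (hε : 0 < ε) :
    ∃ η > (0:ℝ), ∀ (t : ℝ) (f f' f'' : ℝ → ℝ), (∀ x, HasDerivAt f (f' x) x) →
      (∀ x, HasDerivAt f' (f'' x) x) → Continuous f'' → (∀ x, |f' x| ≤ L) → (∀ x, |f'' x| ≤ K) →
      (∫ s in t..(t+δ), (f s)^2) ≤ η →
      (∀ s ∈ Set.Icc t (t+δ), |f s| ≤ ε) ∧ (∫ s in t..(t+δ), (f' s)^2) ≤ ε := by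
  set ε' := min ε (ε / (2*L + K*δ + 1)) with hε'
  have hε'0 : 0 < ε' := by positivity
  obtain ⟨η, hη, H⟩ := aux_sup L δ hL hδ ε' hε'0
  refine ⟨η, hη, ?_⟩
  intro t f f' f'' hf hf' hc hb hb' hint
  have hcf : Continuous f := continuous_iff_continuousAt.2 fun x => (hf x).continuousAt
  have hcf' : Continuous f' := continuous_iff_continuousAt.2 fun x => (hf' x).continuousAt
  have hs := H t f hcf (fun x y => by
    have := Convex.norm_image_sub_le_of_norm_hasDerivWithin_le (f := f) (f' := f') (s := Set.univ)
      (C := L) (fun x _ => (hf x).hasDerivWithinAt) (fun x _ => hb x) convex_univ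
      (Set.mem_univ y) (Set.mem_univ x)
    simpa [Real.norm_eq_abs] using this) hint
  refine ⟨fun s h => (hs s h).trans (min_le_left _ _), ?_⟩
  have hparts := intervalIntegral.integral_mul_deriv_eq_deriv_mul (a := t) (b := t+δ)
    (u := f') (v := f) (u' := f'') (v' := f')
    (fun x _ => hf' x) (fun x _ => hf x) (hc.intervalIntegrable _ _) (hcf'.intervalIntegrable _ _)
  have hbd : ∀ s ∈ Set.Icc t (t+δ), |f' s * f s| ≤ L * ε' := fun s h => by
    rw [abs_mul]; exact mul_le_mul (hb s) (hs s h) (abs_nonneg _) hL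
  have h1 := hbd t ⟨le_rfl, by linarith⟩
  have h2 := hbd (t+δ) ⟨by linarith, le_rfl⟩
  have h3 : ‖∫ x in t..(t+δ), f'' x * f x‖ ≤ (K * ε') * |t + δ - t| := by
    apply intervalIntegral.norm_integral_le_of_norm_le_const
    intro x hx
    rw [Set.uIoc_of_le (by linarith)] at hx
    rw [Real.norm_eq_abs, abs_mul]
    exact mul_le_mul (hb' x) (hs x ⟨hx.1.le, hx.2⟩) (abs_nonneg _) hK
  rw [add_sub_cancel_left, abs_of_pos hδ, Real.norm_eq_abs] at h3
  have h4 : ε' * (2*L + K*δ + 1) ≤ ε := by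
    rw [← le_div_iff₀ (by positivity)]; exact min_le_right _ _
  have h5 : (∫ s in t..(t+δ), (f' s)^2) = ∫ s in t..(t+δ), f' s * f' s := by
    simp only [sq]
  rw [h5, hparts]
  have := abs_le.1 h1; have := abs_le.1 h2; have := abs_le.1 h3
  nlinarith

lemma aux_pe (n : ℕ) (u' : ℝ → Fin n → ℝ) (hc : Continuous u') (δ μ t : ℝ) (hδ : 0 < δ)
    (h : ((1 / δ) • matInt (fun s => vecMulVec (u' s) (u' s)) t (t + δ)
        - μ • (1 : Matrix (Fin n) (Fin n) ℝ)).PosSemidef) (b : Fin n → ℝ) :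
    δ * μ * (b ⬝ᵥ b) ≤ ∫ s in t..(t+δ), (u' s ⬝ᵥ b)^2 := by
  have h0 := h.dotProduct_mulVec_nonneg b
  have hci : ∀ i, Continuous fun s => u' s i := fun i => (continuous_apply i).comp hc
  have h1 : b ⬝ᵥ (matInt (fun s => vecMulVec (u' s) (u' s)) t (t + δ) *ᵥ b)
      = ∫ s in t..(t+δ), (u' s ⬝ᵥ b)^2 := by
    have : ∀ s, (u' s ⬝ᵥ b)^2 = ∑ i, ∑ j, b i * ((u' s i * u' s j) * b j) := by
      intro s
      rw [sq, dotProduct, Finset.sum_mul_sum]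
      refine Finset.sum_congr rfl fun i _ => Finset.sum_congr rfl fun j _ => by ring
    simp only [this]
    rw [intervalIntegral.integral_finsetSum]
    · simp only [dotProduct, mulVec, matInt, Matrix.of_apply, vecMulVec_apply]
      refine Finset.sum_congr rfl fun i _ => ?_
      rw [intervalIntegral.integral_finsetSum, Finset.mul_sum]
      · refine Finset.sum_congr rfl fun j _ => ?_
        rw [intervalIntegral.integral_const_mul, intervalIntegral.integral_mul_const]
      · intro j _
        exact (continuous_const.mul (((hci i).mul (hci j)).mul continuous_const)).intervalIntegrable _ _
    · intro i _
      exact (continuous_finsetSum _ fun j _ => continuous_const.mul (((hci i).mul (hci j)).mul continuous_const)).intervalIntegrable _ _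
  rw [Matrix.sub_mulVec, Matrix.smul_mulVec, Matrix.smul_mulVec, Matrix.one_mulVec,
    dotProduct_sub, dotProduct_smul, dotProduct_smul] at h0
  simp only [star_trivial, smul_eq_mul] at h0
  rw [h1] at h0
  have h2 : μ * (b ⬝ᵥ b) ≤ (∫ s in t..(t+δ), (u' s ⬝ᵥ b)^2) / δ := by
    rw [div_eq_inv_mul, ← one_div]; linarith
  rw [le_div_iff₀ hδ] at h2
  linarith

lemma aux_dot (n : ℕ) (v b : Fin n → ℝ) (c β : ℝ) (hv : ‖v‖ ≤ c) (hb : ∀ i, |b i| ≤ β) :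
    |v ⬝ᵥ b| ≤ n * (c * β) := by
  have hc : 0 ≤ c := (norm_nonneg _).trans hv
  calc |v ⬝ᵥ b| ≤ ∑ i, |v i * b i| := Finset.abs_sum_le_sum_abs _ _
    _ ≤ ∑ i : Fin n, c * β := Finset.sum_le_sum fun i _ => by
        rw [abs_mul]
        exact mul_le_mul ((norm_le_pi_norm v i).trans hv) (hb i) (abs_nonneg _) hc
    _ = n * (c * β) := by simp

lemma aux_coord (n : ℕ) (b : Fin n → ℝ) (i : Fin n) : b i ^ 2 ≤ b ⬝ᵥ b := by
  rw [sq]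
  exact Finset.single_le_sum (f := fun i => b i * b i) (fun i _ => mul_self_nonneg _)
    (Finset.mem_univ i)

lemma aux_key (n : ℕ) (u u' u'' : ℝ → Fin n → ℝ)
    (hu' : ∀ t i, HasDerivAt (fun τ => u τ i) (u' t i) t)
    (hu'' : ∀ t i, HasDerivAt (fun τ => u' τ i) (u'' t i) t)
    (hu''cont : Continuous u'')
    (cu cu' cu'' : ℝ)
    (hub : ∀ t, ‖u t‖ ≤ cu) (hu'b : ∀ t, ‖u' t‖ ≤ cu') (hu''b : ∀ t, ‖u'' t‖ ≤ cu'')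
    (δ μ : ℝ) (hδ : 0 < δ) (hμ : 0 < μ)
    (hpe : ∀ t, 0 ≤ t →
      ((1 / δ) • matInt (fun s => vecMulVec (u' s) (u' s)) t (t + δ)
        - μ • (1 : Matrix (Fin n) (Fin n) ℝ)).PosSemidef) (ε : ℝ) (hε : 0 < ε) :
    ∃ η > (0:ℝ), ∀ t, 0 ≤ t → ∀ (b : Fin n → ℝ) (c : ℝ), (∀ i, |b i| ≤ 2) →
      (∫ s in t..(t+δ), (u s ⬝ᵥ b + c)^2) ≤ η → (∀ i, |b i| ≤ ε) ∧ |c| ≤ ε := by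
  have hcu : 0 ≤ cu := (norm_nonneg _).trans (hub 0)
  have hcu' : 0 ≤ cu' := (norm_nonneg _).trans (hu'b 0)
  have hcu'' : 0 ≤ cu'' := (norm_nonneg _).trans (hu''b 0)
  have hc' : Continuous u' := continuous_pi fun i =>
    continuous_iff_continuousAt.2 fun x => (hu'' x i).continuousAt
  obtain ⟨β, hβ0, hβ1, hβ2⟩ : ∃ β > 0, β ≤ ε ∧ n * (cu * β) ≤ ε/2 := by
    refine ⟨min ε (ε/(2*(n*cu+1))), by positivity, min_le_left _ _, ?_⟩
    have h1 : min ε (ε/(2*(n*cu+1))) ≤ ε/(2*(n*cu+1)) := min_le_right _ _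
    have h2 : (n * cu) * (ε/(2*(n*cu+1))) ≤ ε/2 := by
      rw [mul_div_assoc', div_le_div_iff₀ (by positivity) (by positivity)]
      nlinarith
    have := mul_le_mul_of_nonneg_left h1 (show 0 ≤ n * cu by positivity)
    linarith
  obtain ⟨η, hη, H⟩ := aux_deriv (n * (cu' * 2)) (n * (cu'' * 2)) δ (by positivity) (by positivity) hδ
    (min (ε/2) (δ * μ * β^2)) (by positivity)
  refine ⟨η, hη, ?_⟩
  intro t ht b c hb hint
  obtain ⟨h1, h2⟩ := H t (fun s => u s ⬝ᵥ b + c) (fun s => u' s ⬝ᵥ b) (fun s => u'' s ⬝ᵥ b)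
    (fun x => by
      simp only [dotProduct]
      exact (HasDerivAt.fun_sum fun i _ => (hu' x i).mul_const (b i)).add_const c)
    (fun x => by
      simp only [dotProduct]
      exact (HasDerivAt.fun_sum fun i _ => (hu'' x i).mul_const (b i)))
    (by
      simp only [dotProduct]
      exact continuous_finsetSum _ fun i _ => ((continuous_apply i).comp hu''cont).mul continuous_const)
    (fun x => aux_dot n _ _ _ _ (hu'b x) hb) (fun x => aux_dot n _ _ _ _ (hu''b x) hb) hint
  have h3 := aux_pe n u' hc' δ μ t hδ (hpe t ht) b
  have h4 : b ⬝ᵥ b ≤ β^2 := by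
    have h5 := h3.trans (h2.trans (min_le_right _ _))
    exact le_of_mul_le_mul_left h5 (by positivity)
  have h6 : ∀ i, |b i| ≤ β := fun i => abs_le_of_sq_le_sq ((aux_coord n b i).trans h4) hβ0.le
  refine ⟨fun i => (h6 i).trans hβ1, ?_⟩
  have h7 := (h1 t ⟨le_rfl, by linarith⟩).trans (min_le_left _ _)
  have h8 := aux_dot n _ _ _ _ (hub t) h6
  have h9 : |c| ≤ |u t ⬝ᵥ b + c| + |u t ⬝ᵥ b| := by
    have := abs_sub (u t ⬝ᵥ b + c) (u t ⬝ᵥ b)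
    simpa using this
  linarith

lemma aux_dot_le (n : ℕ) (b : Fin n → ℝ) (e : ℝ) (h : ∀ i, |b i| ≤ e) : b ⬝ᵥ b ≤ n * e^2 := by
  calc b ⬝ᵥ b ≤ ∑ i : Fin n, e^2 := Finset.sum_le_sum fun i _ => by
        rw [← sq, ← sq_abs]; exact pow_le_pow_left₀ (abs_nonneg _) (h i) 2
    _ = n * e^2 := by simp

/-- Lemma 7 of the paper (observability for a single range measurement with biased
velocity): persistent excitation of `u̇` implies a uniform lower bound for the Grammian
quadratic form of `M(s)` with rows `[0,0,1,0,0]`, `[u(s)ᵀ,0,0,1,0]`,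
`[u̇(s)ᵀ, 2u(s)ᵀ, 0,0,1]`. -/
theorem pe_range_biased_grammian
    (n : ℕ) (u u' u'' : ℝ → Fin n → ℝ)
    (hu' : ∀ t i, HasDerivAt (fun τ => u τ i) (u' t i) t)
    (hu'' : ∀ t i, HasDerivAt (fun τ => u' τ i) (u'' t i) t)
    (hu''cont : Continuous u'')
    (cu cu' cu'' : ℝ)
    (hub : ∀ t, ‖u t‖ ≤ cu) (hu'b : ∀ t, ‖u' t‖ ≤ cu') (hu''b : ∀ t, ‖u'' t‖ ≤ cu'')
    (δ μ : ℝ) (hδ : 0 < δ) (hμ : 0 < μ)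
    (hpe : ∀ t, 0 ≤ t →
      ((1 / δ) • matInt (fun s => vecMulVec (u' s) (u' s)) t (t + δ)
        - μ • (1 : Matrix (Fin n) (Fin n) ℝ)).PosSemidef) :
    ∃ μ' > (0 : ℝ), ∀ t, 0 ≤ t →
      ∀ (b₁ b₂ : Fin n → ℝ) (c₁ c₂ c₃ : ℝ),
        b₁ ⬝ᵥ b₁ + b₂ ⬝ᵥ b₂ + c₁ ^ 2 + c₂ ^ 2 + c₃ ^ 2 = 1 →
        (1 / δ) * ∫ s in t..(t + δ),
          (c₁ ^ 2 + (u s ⬝ᵥ b₁ + c₂) ^ 2 +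
            (u' s ⬝ᵥ b₁ + 2 * (u s ⬝ᵥ b₂) + c₃) ^ 2) ≥ μ' := by
  have hcu' : 0 ≤ cu' := (norm_nonneg _).trans (hu'b 0)
  have hc : Continuous u := continuous_pi fun i =>
    continuous_iff_continuousAt.2 fun x => (hu' x i).continuousAt
  have hc' : Continuous u' := continuous_pi fun i =>
    continuous_iff_continuousAt.2 fun x => (hu'' x i).continuousAt
  have key := aux_key n u u' u'' hu' hu'' hu''cont cu cu' cu'' hub hu'b hu''b δ μ hδ hμ hpe
  obtain ⟨e, he0, he⟩ : ∃ e > (0:ℝ), (2*n+3) * e^2 < 1 := by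
    refine ⟨1/(2*n+4), by positivity, ?_⟩
    rw [div_pow, mul_div_assoc', div_lt_one (by positivity)]
    have : (0:ℝ) ≤ n := by positivity
    nlinarith
  obtain ⟨η₂, hη₂, H₂⟩ := key e he0
  obtain ⟨e₁, he₁0, he₁, he₁'⟩ : ∃ e₁ > 0, e₁ ≤ e ∧ 2 * (δ * (n * (cu' * e₁))^2) ≤ η₂/2 := by
    set A := 2 * (δ * (n * cu')^2) with hA
    have hA0 : 0 ≤ A := by positivity
    refine ⟨min e (min 1 (η₂/(2*(A+1)))), by positivity, min_le_left _ _, ?_⟩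
    set x := min e (min 1 (η₂/(2*(A+1)))) with hx
    have hx0 : 0 < x := by positivity
    have hx1 : x ≤ 1 := (min_le_right _ _).trans (min_le_left _ _)
    have hx2 : x ≤ η₂/(2*(A+1)) := (min_le_right _ _).trans (min_le_right _ _)
    rw [le_div_iff₀ (by positivity)] at hx2
    have h1 : 2 * (δ * (n * (cu' * x))^2) = A * x^2 := by rw [hA]; ring
    rw [h1]
    have h2 : x^2 ≤ x := by nlinarith
    have h3 := mul_le_mul_of_nonneg_left h2 hA0
    nlinarith
  obtain ⟨η₁, hη₁, H₁⟩ := key e₁ he₁0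
  set η := min η₁ (min (η₂/4) (δ * e^2)) with hη
  have hη0 : 0 < η := by positivity
  refine ⟨η/δ, by positivity, ?_⟩
  intro t ht b₁ b₂ c₁ c₂ c₃ hsum
  by_contra! hcon
  have hcd : ∀ b : Fin n → ℝ, Continuous fun s => u s ⬝ᵥ b := fun b => by
    simp only [dotProduct]
    exact continuous_finsetSum _ fun i _ => ((continuous_apply i).comp hc).mul continuous_const
  have hcd' : ∀ b : Fin n → ℝ, Continuous fun s => u' s ⬝ᵥ b := fun b => by
    simp only [dotProduct]
    exact continuous_finsetSum _ fun i _ => ((continuous_apply i).comp hc').mul continuous_const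
  have hg : Continuous fun s => (u s ⬝ᵥ b₁ + c₂) ^ 2 := ((hcd b₁).add continuous_const).pow 2
  have hh : Continuous fun s => (u' s ⬝ᵥ b₁ + 2 * (u s ⬝ᵥ b₂) + c₃) ^ 2 :=
    (((hcd' b₁).add (continuous_const.mul (hcd b₂))).add continuous_const).pow 2
  have hcg : Continuous fun s => c₁ ^ 2 + (u s ⬝ᵥ b₁ + c₂) ^ 2 := continuous_const.add hg
  have hch : Continuous fun s => 2 * (u' s ⬝ᵥ b₁ + 2 * (u s ⬝ᵥ b₂) + c₃) ^ 2 :=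
    continuous_const.mul hh
  have htd : t ≤ t + δ := by linarith
  rw [intervalIntegral.integral_add (hcg.intervalIntegrable _ _)
    (hh.intervalIntegrable _ _), intervalIntegral.integral_add
    (continuous_const.intervalIntegrable _ _) (hg.intervalIntegrable _ _),
    intervalIntegral.integral_const, add_sub_cancel_left, smul_eq_mul, one_div, inv_mul_eq_div,
    div_lt_div_iff_of_pos_right hδ] at hcon
  have hg0 : 0 ≤ ∫ s in t..(t+δ), (u s ⬝ᵥ b₁ + c₂) ^ 2 :=
    intervalIntegral.integral_nonneg htd fun s _ => sq_nonneg _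
  have hh0 : 0 ≤ ∫ s in t..(t+δ), (u' s ⬝ᵥ b₁ + 2 * (u s ⬝ᵥ b₂) + c₃) ^ 2 :=
    intervalIntegral.integral_nonneg htd fun s _ => sq_nonneg _
  have hc0 : 0 ≤ δ * c₁^2 := by positivity
  have hl1 : η ≤ η₁ := min_le_left _ _
  have hl2 : η ≤ η₂/4 := (min_le_right _ _).trans (min_le_left _ _)
  have hl3 : η ≤ δ * e^2 := (min_le_right _ _).trans (min_le_right _ _)
  have hn1 : 0 ≤ b₁ ⬝ᵥ b₁ := Finset.sum_nonneg fun i _ => mul_self_nonneg _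
  have hn2 : 0 ≤ b₂ ⬝ᵥ b₂ := Finset.sum_nonneg fun i _ => mul_self_nonneg _
  have hb1 : ∀ i, |b₁ i| ≤ 1 := fun i => abs_le_of_sq_le_sq (by
    nlinarith [aux_coord n b₁ i, sq_nonneg c₁, sq_nonneg c₂, sq_nonneg c₃]) zero_le_one
  have hb2 : ∀ i, |b₂ i| ≤ 1 := fun i => abs_le_of_sq_le_sq (by
    nlinarith [aux_coord n b₂ i, sq_nonneg c₁, sq_nonneg c₂, sq_nonneg c₃]) zero_le_one
  obtain ⟨k1, k2⟩ := H₁ t ht b₁ c₂ (fun i => (hb1 i).trans one_le_two) (by linarith)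
  have hI : (∫ s in t..(t+δ), (u s ⬝ᵥ ((2:ℝ) • b₂) + c₃)^2) ≤ η₂ := by
    have h1 : (∫ s in t..(t+δ), (u s ⬝ᵥ ((2:ℝ) • b₂) + c₃)^2) ≤
        ∫ s in t..(t+δ), (2 * (u' s ⬝ᵥ b₁ + 2 * (u s ⬝ᵥ b₂) + c₃) ^ 2
          + 2 * (n * (cu' * e₁))^2) := by
      apply intervalIntegral.integral_mono_on htd
      · exact (((hcd _).add continuous_const).pow 2).intervalIntegrable _ _
      · exact ((continuous_const.mul hh).add continuous_const).intervalIntegrable _ _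
      · intro s _
        have h2 : (u' s ⬝ᵥ b₁)^2 ≤ (n * (cu' * e₁))^2 := by
          rw [← sq_abs]
          exact pow_le_pow_left₀ (abs_nonneg _) (aux_dot n _ _ _ _ (hu'b s) k1) 2
        rw [dotProduct_smul, smul_eq_mul]
        nlinarith [sq_nonneg (2 * (u' s ⬝ᵥ b₁) + 2 * (u s ⬝ᵥ b₂) + c₃)]
    rw [intervalIntegral.integral_add (hch.intervalIntegrable _ _)
      (continuous_const.intervalIntegrable _ _), intervalIntegral.integral_const_mul,
      intervalIntegral.integral_const, add_sub_cancel_left, smul_eq_mul] at h1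
    linarith
  obtain ⟨k3, k4⟩ := H₂ t ht ((2:ℝ) • b₂) c₃ (fun i => by
    have := hb2 i
    simp only [Pi.smul_apply, smul_eq_mul, abs_mul, abs_two]; linarith) hI
  have m1 := aux_dot_le n b₁ e fun i => (k1 i).trans he₁
  have m2 := aux_dot_le n b₂ e fun i => by
    have := k3 i
    simp only [Pi.smul_apply, smul_eq_mul, abs_mul, abs_two] at this
    linarith [abs_nonneg (b₂ i)]
  have m3 : c₁^2 ≤ e^2 := le_of_mul_le_mul_left (by linarith : δ * c₁^2 ≤ δ * e^2) hδ
  have m4 : c₂^2 ≤ e^2 := by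
    rw [← sq_abs]; exact pow_le_pow_left₀ (abs_nonneg _) (k2.trans he₁) 2
  have m5 : c₃^2 ≤ e^2 := by
    rw [← sq_abs]; exact pow_le_pow_left₀ (abs_nonneg _) k4 2
  nlinarith
end

section
/- Let n ≥ 2 and l ≥ n+2. Let x ∈ ℝⁿ, let d₁, …, d_l > 0, let r₁, …, r_l ∈ ℝⁿ be unit vectors, set zᵢ := x − dᵢrᵢ, let b ∈ ℝ and set ȳᵢ := dᵢ + b (so ȳ ∈ ℝ^l). Let α ∈ ℝ^l with Σαᵢ = 1, ξ := (1,…,1)ᵀ, D(α) := ξαᵀ − I_l, Z := [z₁ … z_l]. Assume rank(D(α)·Zᵀ) = n and that no w ∈ ℝⁿ satisfies d₁(1 + wᵀr₁) = d₂(1 + wᵀr₂) = ⋯ = d_l(1 + wᵀr_l). Then the only triple (v₁, v₂, v₃) ∈ ℝⁿ × ℝ × ℝ satisfying both v₂ + (αᵀȳ)·v₃ = 0 and D(α)Zᵀ·v₁ − D(α)ȳ·v₃ = 0 is v₁ = 0, v₂ = 0, v₃ = 0; that is, the constant observability matrix of the biased-range estimation problem in the static case has trivial kernel. -/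
open Matrix

/-- First part of Lemma 10 of the paper (static biased-range case): if at least `n+2`
source points are used, `rank(D(α)Zᵀ) = n`, and no `w` satisfies
`d₁(1+wᵀr₁) = ⋯ = d_l(1+wᵀr_l)`, then the constant observability matrix of the
biased-range estimation problem has trivial kernel. -/
theorem static_biased_range_trivial_kernel
    (n l : ℕ) (hn : 2 ≤ n) (hl : n + 2 ≤ l)
    (x : Fin n → ℝ)
    (d : Fin l → ℝ) (hd : ∀ i, 0 < d i)
    (r : Fin l → Fin n → ℝ) (hr : ∀ i, r i ⬝ᵥ r i = 1)
    (z : Fin l → Fin n → ℝ) (hz : ∀ i, z i = x - d i • r i)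
    (b : ℝ) (yb : Fin l → ℝ) (hyb : yb = fun i => d i + b)
    (α : Fin l → ℝ) (hα : ∑ i, α i = 1)
    (ξ : Fin l → ℝ) (hξ : ξ = fun _ => 1)
    (D : Matrix (Fin l) (Fin l) ℝ) (hD : D = vecMulVec ξ α - 1)
    (Z : Matrix (Fin n) (Fin l) ℝ) (hZ : Z = Matrix.of fun i j => z j i)
    (hrank : (D * Zᵀ).rank = n)
    (hnow : ∀ w : Fin n → ℝ, ∃ i j : Fin l,
      d i * (1 + w ⬝ᵥ r i) ≠ d j * (1 + w ⬝ᵥ r j)) :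
    ∀ (v₁ : Fin n → ℝ) (v₂ v₃ : ℝ),
      v₂ + (α ⬝ᵥ yb) * v₃ = 0 →
      (D * Zᵀ) *ᵥ v₁ - v₃ • (D *ᵥ yb) = 0 →
      v₁ = 0 ∧ v₂ = 0 ∧ v₃ = 0 := by
  intro v₁ v₂ v₃ h1 h2
  have hinj : ∀ v : Fin n → ℝ, (D * Zᵀ) *ᵥ v = 0 → v = 0 := by
    have h := LinearMap.finrank_range_add_finrank_ker (D * Zᵀ).mulVecLin
    have h' : Module.finrank ℝ (LinearMap.range (D * Zᵀ).mulVecLin) = n := hrank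
    rw [h', Module.finrank_fin_fun] at h
    have hk : Module.finrank ℝ (LinearMap.ker (D * Zᵀ).mulVecLin) = 0 := by omega
    have hb := Submodule.finrank_eq_zero.mp hk
    intro v hv
    have : v ∈ LinearMap.ker (D * Zᵀ).mulVecLin := by
      exact LinearMap.mem_ker.mpr hv
    rw [hb] at this
    simpa using this
  have hv3 : v₃ = 0 := by
    by_contra hne
    obtain ⟨i, j, hij⟩ := hnow (v₃⁻¹ • v₁)
    have hu : ∀ u : Fin l → ℝ, D *ᵥ u = 0 → ∀ i, u i = α ⬝ᵥ u := by
      intro u hu i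
      have := congrFun hu i
      rw [hD, hξ, Matrix.sub_mulVec, Matrix.one_mulVec, Matrix.vecMulVec_mulVec] at this
      simp at this
      linarith
    have h3 : D *ᵥ (Zᵀ *ᵥ v₁ - v₃ • yb) = 0 := by
      rw [Matrix.mulVec_sub, Matrix.mulVec_smul, Matrix.mulVec_mulVec]
      exact h2
    have hval : ∀ k, (Zᵀ *ᵥ v₁ - v₃ • yb) k
        = x ⬝ᵥ v₁ - v₃ * b - v₃ * (d k * (1 + (v₃⁻¹ • v₁) ⬝ᵥ r k)) := by
      intro k
      have hzk : (Zᵀ *ᵥ v₁) k = z k ⬝ᵥ v₁ := by rw [hZ]; rfl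
      rw [Pi.sub_apply, hzk, hz, hyb, sub_dotProduct, smul_dotProduct, smul_dotProduct,
        dotProduct_comm v₁]
      simp only [Pi.smul_apply, smul_eq_mul]
      field_simp
      ring
    have e := (hu _ h3 i).trans (hu _ h3 j).symm
    rw [hval, hval] at e
    exact hij (mul_left_cancel₀ hne (by linarith))
  subst hv3
  refine ⟨hinj _ (by simpa using h2), by simpa using h1, rfl⟩
end

section
/- Let l ≥ 1, z₁, …, z_l ∈ ℝⁿ, α ∈ ℝ^l with Σαᵢ = 1, ξ := (1,…,1)ᵀ, D(α) := ξαᵀ − I_l, Z := [z₁ … z_l]. Let u : ℝ → ℝⁿ be bounded and continuously differentiable with bounded derivative, and let ȳ : ℝ → ℝ^l be bounded and twice continuously differentiable with bounded first and second derivatives. Assume: (C1) there exist δ > 0 and μ > 0 such that Z·D(α)ᵀD(α)·Zᵀ + (1/δ)∫_t^{t+δ} u(s)u(s)ᵀ ds ≥ μ·Iₙ for all t ≥ 0; and (C2) there exists ν > 0 such that for every t ≥ 0 there is τ ∈ [t, t+δ] with |ẏ̄(τ)| > ν. Then there exists μ̄ > 0 such that for all t ≥ 0 and all (v₁, v₂,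 v₃) ∈ ℝⁿ × ℝ × ℝ with |v₁|² + v₂² + v₃² = 1, one has (1/δ)∫_t^{t+δ} [ (v₂ + αᵀȳ(s)·v₃)² + |D(α)Zᵀ·v₁ − D(α)ȳ(s)·v₃|² + (u(s)ᵀv₁)² ] ds ≥ μ̄. -/
open Matrix MeasureTheory

lemma aux_1d (f f' f'' : ℝ → ℝ) (hf : ∀ t, HasDerivAt f (f' t) t)
    (hf' : ∀ t, HasDerivAt f' (f'' t) t) (M ν r δ : ℝ) (hM : ∀ t, |f'' t| ≤ M)
    (hν : 0 < ν) (hr : 0 < r) (hrδ : 4 * r ≤ δ) (hrM : M * (2 * r) ≤ ν / 2)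
    (t τ : ℝ) (hτ : τ ∈ Set.Icc t (t + δ)) (hfτ : ν ≤ |f' τ|) (v k : ℝ) :
    ν ^ 2 * r ^ 3 / 8 * v ^ 2 ≤ ∫ s in t..(t + δ), (v * f s + k) ^ 2 := by
  have hM0 : 0 ≤ M := (abs_nonneg _).trans (hM 0)
  have hfc : Continuous f := continuous_iff_continuousAt.2 fun x => (hf x).continuousAt
  obtain ⟨p, hp1, hp2, hp3, hp4⟩ : ∃ p, t ≤ p ∧ p + 2 * r ≤ t + δ ∧ p ≤ τ ∧ τ ≤ p + 2 * r := by
    rcases le_total τ (t + 2 * r) with h | h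
    · exact ⟨t, le_rfl, by linarith, hτ.1, h⟩
    · exact ⟨τ - 2 * r, by linarith, by linarith [hτ.2], by linarith, by linarith⟩
  have hgc : Continuous fun s => (v * f s + k) ^ 2 := by fun_prop
  have hlow : ∀ c ∈ Set.Icc p (p + 2 * r), ν / 2 ≤ |f' c| := by
    intro c hc
    have h1 : ‖f' c - f' τ‖ ≤ M * ‖c - τ‖ :=
      Convex.norm_image_sub_le_of_norm_hasDerivWithin_le (s := Set.univ) (f := f') (f' := f'')
        (fun x _ => (hf' x).hasDerivWithinAt) (fun x _ => hM x) convex_univ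
        (Set.mem_univ _) (Set.mem_univ _)
    rw [Real.norm_eq_abs, Real.norm_eq_abs] at h1
    have h2 : |c - τ| ≤ 2 * r := abs_le.2 ⟨by linarith [hc.1], by linarith [hc.2]⟩
    have h3 : M * |c - τ| ≤ M * (2 * r) := mul_le_mul_of_nonneg_left h2 hM0
    have h4 := abs_sub_abs_le_abs_sub (f' τ) (f' c)
    rw [abs_sub_comm] at h4
    linarith
  have hpt : ∀ s ∈ Set.Icc p (p + r),
      ν ^ 2 * r ^ 2 / 8 * v ^ 2 ≤ (v * f s + k) ^ 2 + (v * f (s + r) + k) ^ 2 := by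
    intro s hs
    obtain ⟨c, hc, hce⟩ := exists_hasDerivAt_eq_slope f f' (show s < s + r by linarith)
      hfc.continuousOn (fun x _ => hf x)
    have hcl := hlow c ⟨by linarith [hs.1, hc.1], by linarith [hs.2, hc.2]⟩
    have he : f (s + r) - f s = f' c * r := by
      rw [hce, add_sub_cancel_left, div_mul_cancel₀ _ hr.ne']
    have h5 : (ν / 2) ^ 2 ≤ f' c ^ 2 := by
      rw [← sq_abs (f' c)]; gcongr
    have h6 : v ^ 2 * r ^ 2 * (ν / 2) ^ 2 ≤ v ^ 2 * r ^ 2 * f' c ^ 2 := by gcongr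
    have h7 : f (s + r) = f s + f' c * r := by linarith
    rw [h7]
    nlinarith [sq_nonneg ((v * f s + k) + (v * (f s + f' c * r) + k))]
  have hI : ∀ a b, IntervalIntegrable (fun s => (v * f s + k) ^ 2) volume a b :=
    fun a b => hgc.intervalIntegrable a b
  have e1 : ∫ s in p..(p + r), (v * f (s + r) + k) ^ 2
      = ∫ s in (p + r)..(p + 2 * r), (v * f s + k) ^ 2 := by
    rw [intervalIntegral.integral_comp_add_right (fun s => (v * f s + k) ^ 2)]
    congr 1; ring
  have e2 : ∫ s in p..(p + 2 * r), (v * f s + k) ^ 2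
      = ∫ s in p..(p + r), ((v * f s + k) ^ 2 + (v * f (s + r) + k) ^ 2) := by
    rw [intervalIntegral.integral_add (hI _ _)
      ((by fun_prop : Continuous fun s => (v * f (s + r) + k) ^ 2).intervalIntegrable _ _), e1,
      intervalIntegral.integral_add_adjacent_intervals (hI _ _) (hI _ _)]
  have e3 : ∫ s in p..(p + r), (ν ^ 2 * r ^ 2 / 8 * v ^ 2)
      ≤ ∫ s in p..(p + r), ((v * f s + k) ^ 2 + (v * f (s + r) + k) ^ 2) :=
    intervalIntegral.integral_mono_on (by linarith) (by simp)
      ((by fun_prop : Continuous fun s =>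
        (v * f s + k) ^ 2 + (v * f (s + r) + k) ^ 2).intervalIntegrable _ _) hpt
  have e4 : ∫ s in p..(p + 2 * r), (v * f s + k) ^ 2 ≤ ∫ s in t..(t + δ), (v * f s + k) ^ 2 :=
    intervalIntegral.integral_mono_interval hp1 (by linarith) hp2
      (Filter.Eventually.of_forall fun s => sq_nonneg _) (hI _ _)
  rw [intervalIntegral.integral_const, smul_eq_mul] at e3
  calc _ = (p + r - p) * (ν ^ 2 * r ^ 2 / 8 * v ^ 2) := by ring
    _ ≤ _ := by linarith

lemma aux_quad {n : ℕ} (u : ℝ → Fin n → ℝ) (hu : Continuous u) (a b : ℝ) (v : Fin n → ℝ) :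
    v ⬝ᵥ (matInt (fun s => vecMulVec (u s) (u s)) a b *ᵥ v) = ∫ s in a..b, (u s ⬝ᵥ v) ^ 2 := by
  have hc : ∀ i, Continuous fun s => u s i := fun i => (continuous_apply i).comp hu
  have h1 : ∀ s, (u s ⬝ᵥ v) ^ 2 = ∑ i, ∑ j, v i * (u s i * u s j) * v j := by
    intro s
    rw [sq, dotProduct, Finset.sum_mul_sum]
    refine Finset.sum_congr rfl fun i _ => Finset.sum_congr rfl fun j _ => by ring
  simp_rw [h1]
  rw [intervalIntegral.integral_finsetSum]
  · simp only [dotProduct, mulVec, matInt, Matrix.of_apply, vecMulVec_apply, Finset.mul_sum]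
    refine Finset.sum_congr rfl fun i _ => ?_
    rw [intervalIntegral.integral_finsetSum]
    · refine Finset.sum_congr rfl fun j _ => ?_
      rw [intervalIntegral.integral_mul_const, intervalIntegral.integral_const_mul]; ring
    · intro j _
      have := hc i; have := hc j
      exact Continuous.intervalIntegrable (by fun_prop) _ _
  · intro i _
    have := hc i
    exact Continuous.intervalIntegrable (by fun_prop) _ _

set_option maxHeartbeats 2000000

/-- Second part of Lemma 10 of the paper (moving body, biased range measurements):
under conditions (C1) and (C2), the Grammian quadratic form of
`M(s) = [[0, 1, αᵀȳ(s)], [D(α)Zᵀ, 0, −D(α)ȳ(s)], [u(s)ᵀ, 0, 0]]` is uniformly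
bounded below by some `μ̄ > 0`. -/
theorem pe_biased_range_moving_grammian
    (n l : ℕ) (hl : 1 ≤ l)
    (z : Fin l → Fin n → ℝ)
    (α : Fin l → ℝ) (hα : ∑ i, α i = 1)
    (ξ : Fin l → ℝ) (hξ : ξ = fun _ => 1)
    (D : Matrix (Fin l) (Fin l) ℝ) (hD : D = vecMulVec ξ α - 1)
    (Z : Matrix (Fin n) (Fin l) ℝ) (hZ : Z = Matrix.of fun i j => z j i)
    (u u' : ℝ → Fin n → ℝ)
    (hu' : ∀ t i, HasDerivAt (fun τ => u τ i) (u' t i) t)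
    (hu'cont : Continuous u')
    (cu cu' : ℝ) (hub : ∀ t, ‖u t‖ ≤ cu) (hu'b : ∀ t, ‖u' t‖ ≤ cu')
    (yb yb' yb'' : ℝ → Fin l → ℝ)
    (hyb' : ∀ t i, HasDerivAt (fun τ => yb τ i) (yb' t i) t)
    (hyb'' : ∀ t i, HasDerivAt (fun τ => yb' τ i) (yb'' t i) t)
    (hyb''cont : Continuous yb'')
    (cy cy' cy'' : ℝ)
    (hybb : ∀ t, ‖yb t‖ ≤ cy) (hyb'b : ∀ t, ‖yb' t‖ ≤ cy') (hyb''b : ∀ t, ‖yb'' t‖ ≤ cy'')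
    (δ μ : ℝ) (hδ : 0 < δ) (hμ : 0 < μ)
    (hC1 : ∀ t, 0 ≤ t →
      (Z * Dᵀ * D * Zᵀ + (1 / δ) • matInt (fun s => vecMulVec (u s) (u s)) t (t + δ)
        - μ • (1 : Matrix (Fin n) (Fin n) ℝ)).PosSemidef)
    (ν : ℝ) (hν : 0 < ν)
    (hC2 : ∀ t, 0 ≤ t → ∃ τ ∈ Set.Icc t (t + δ), Real.sqrt (yb' τ ⬝ᵥ yb' τ) > ν) :
    ∃ μ' > (0 : ℝ), ∀ t, 0 ≤ t →
      ∀ (v₁ : Fin n → ℝ) (v₂ v₃ : ℝ), v₁ ⬝ᵥ v₁ + v₂ ^ 2 + v₃ ^ 2 = 1 →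
        (1 / δ) * ∫ s in t..(t + δ),
          ((v₂ + (α ⬝ᵥ yb s) * v₃) ^ 2 +
            ((D * Zᵀ) *ᵥ v₁ - v₃ • (D *ᵥ yb s)) ⬝ᵥ ((D * Zᵀ) *ᵥ v₁ - v₃ • (D *ᵥ yb s)) +
            (u s ⬝ᵥ v₁) ^ 2) ≥ μ' := by
  have hyc : Continuous yb := continuous_pi fun i =>
    continuous_iff_continuousAt.2 fun x => (hyb' x i).continuousAt
  have huc : Continuous u := continuous_pi fun i =>
    continuous_iff_continuousAt.2 fun x => (hu' x i).continuousAt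
  have hl0 : (1 : ℝ) ≤ l := by exact_mod_cast hl
  -- bounds
  have bdd : ∀ F : (Fin l → ℝ) → ℝ, Continuous F → ∃ C, 0 ≤ C ∧ ∀ s, F (yb s) ≤ C := by
    intro F hF
    obtain ⟨C, hC⟩ := (isCompact_closedBall (0 : Fin l → ℝ) cy).exists_bound_of_continuousOn
      hF.continuousOn
    have h : ∀ s, ‖F (yb s)‖ ≤ C := fun s => hC _ (by simpa using hybb s)
    exact ⟨C, (norm_nonneg _).trans (h 0), fun s => (le_abs_self _).trans (h s)⟩
  obtain ⟨C₁, hC₁0, hC₁⟩ := bdd (fun w => (D *ᵥ w) ⬝ᵥ (D *ᵥ w)) (by fun_prop)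
  obtain ⟨C₂, hC₂0, hC₂⟩ := bdd (fun w => (α ⬝ᵥ w) ^ 2) (by fun_prop)
  -- constants
  have hcy0 : 0 ≤ cy'' := (norm_nonneg _).trans (hyb''b 0)
  set ν₁ : ℝ := ν / l with hν₁
  have hν₁0 : 0 < ν₁ := by positivity
  obtain ⟨r, hr0, hrδ, hrM⟩ : ∃ r : ℝ, 0 < r ∧ 4 * r ≤ δ ∧ cy'' * (2 * r) ≤ ν₁ / 2 := by
    refine ⟨min (δ / 4) (ν₁ / (4 * (cy'' + 1))), by positivity, ?_, ?_⟩
    · linarith [min_le_left (δ / 4) (ν₁ / (4 * (cy'' + 1)))]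
    · have h1 := min_le_right (δ / 4) (ν₁ / (4 * (cy'' + 1)))
      have h0 : 0 < min (δ / 4) (ν₁ / (4 * (cy'' + 1))) := by positivity
      rw [le_div_iff₀ (by positivity)] at h1
      nlinarith
  set κ : ℝ := ν₁ ^ 2 * r ^ 3 / 8 with hκ
  have hκ0 : 0 < κ := by positivity
  -- K
  set K₃ : ℝ := 2 * δ / κ with hK₃
  have hK₃0 : 0 < K₃ := by positivity
  set K : ℝ := (2 + 2 * C₁ * K₃) / μ + (2 + 2 * C₂ * K₃) + K₃ with hK
  have hK0 : 0 < K := by positivity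
  refine ⟨1 / K, by positivity, ?_⟩
  intro t ht v₁ v₂ v₃ hv
  set q : Fin l → ℝ := (D * Zᵀ) *ᵥ v₁ with hq
  have nonnegdot : ∀ w : Fin l → ℝ, 0 ≤ w ⬝ᵥ w := fun w =>
    Finset.sum_nonneg fun i _ => mul_self_nonneg _
  have ca : Continuous fun s => (v₂ + (α ⬝ᵥ yb s) * v₃) ^ 2 := by fun_prop
  have cb : Continuous fun s => (q - v₃ • (D *ᵥ yb s)) ⬝ᵥ (q - v₃ • (D *ᵥ yb s)) := by fun_prop
  have cc : Continuous fun s => (u s ⬝ᵥ v₁) ^ 2 := by fun_prop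
  set A := ∫ s in t..(t + δ), (v₂ + (α ⬝ᵥ yb s) * v₃) ^ 2 with hA
  set B := ∫ s in t..(t + δ), (q - v₃ • (D *ᵥ yb s)) ⬝ᵥ (q - v₃ • (D *ᵥ yb s)) with hB
  set E := ∫ s in t..(t + δ), (u s ⬝ᵥ v₁) ^ 2 with hE
  have htδ : t ≤ t + δ := by linarith
  have hA0 : 0 ≤ A := intervalIntegral.integral_nonneg htδ fun s _ => sq_nonneg _
  have hB0 : 0 ≤ B := intervalIntegral.integral_nonneg htδ fun s _ => nonnegdot _
  have hE0 : 0 ≤ E := intervalIntegral.integral_nonneg htδ fun s _ => sq_nonneg _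
  rw [intervalIntegral.integral_add (Continuous.intervalIntegrable (by fun_prop) _ _)
    (cc.intervalIntegrable _ _), intervalIntegral.integral_add (ca.intervalIntegrable _ _)
    (cb.intervalIntegrable _ _), ← hA, ← hB, ← hE]
  -- step 1
  have s1 : κ * v₃ ^ 2 ≤ 2 * (A + B) := by
    obtain ⟨τ, hτ, hτν⟩ := hC2 t ht
    obtain ⟨i, hi⟩ : ∃ i, ν₁ ≤ |yb' τ i| := by
      by_contra! hcon
      have h1 : yb' τ ⬝ᵥ yb' τ ≤ ∑ i : Fin l, ν₁ ^ 2 := by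
        refine Finset.sum_le_sum fun i _ => ?_
        rw [← sq, ← sq_abs]
        exact pow_le_pow_left₀ (abs_nonneg _) (hcon i).le 2
      have h2 : ν ^ 2 < yb' τ ⬝ᵥ yb' τ := by
        exact (Real.lt_sqrt hν.le).1 hτν
      have h3 : ∑ i : Fin l, ν₁ ^ 2 = ν ^ 2 / l := by
        simp [hν₁]; field_simp
      have h4 : ν ^ 2 / l ≤ ν ^ 2 := div_le_self (sq_nonneg _) hl0
      linarith
    have h := aux_1d (fun s => yb s i) (fun s => yb' s i) (fun s => yb'' s i)
      (fun s => hyb' s i) (fun s => hyb'' s i) cy'' ν₁ r δ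
      (fun s => (norm_le_pi_norm (yb'' s) i).trans (hyb''b s)) hν₁0 hr0 hrδ hrM t τ hτ hi v₃
      (v₂ + q i)
    refine h.trans ?_
    rw [hA, hB, ← intervalIntegral.integral_add (ca.intervalIntegrable _ _)
      (cb.intervalIntegrable _ _), ← intervalIntegral.integral_const_mul]
    refine intervalIntegral.integral_mono_on htδ
      (Continuous.intervalIntegrable (by fun_prop) _ _)
      (Continuous.intervalIntegrable (by fun_prop) _ _) ?_
    intro s _
    have hb : (q - v₃ • (D *ᵥ yb s)) i = q i - v₃ * ((α ⬝ᵥ yb s) - yb s i) := by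
      have : (D *ᵥ yb s) i = (α ⬝ᵥ yb s) - yb s i := by
        rw [hD, hξ, sub_mulVec, one_mulVec]
        simp [mulVec, dotProduct, vecMulVec_apply]
      simp [this]
    have hbi : ((q - v₃ • (D *ᵥ yb s)) i) ^ 2 ≤
        (q - v₃ • (D *ᵥ yb s)) ⬝ᵥ (q - v₃ • (D *ᵥ yb s)) := by
      rw [sq]
      exact Finset.single_le_sum
        (f := fun i => (q - v₃ • (D *ᵥ yb s)) i * (q - v₃ • (D *ᵥ yb s)) i)
        (fun i _ => mul_self_nonneg _) (Finset.mem_univ i)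
    rw [hb] at hbi
    nlinarith [sq_nonneg (v₂ + (α ⬝ᵥ yb s) * v₃ - (q i - v₃ * ((α ⬝ᵥ yb s) - yb s i)))]
  -- step 2
  have s2 : δ * (q ⬝ᵥ q) ≤ 2 * B + 2 * C₁ * v₃ ^ 2 * δ := by
    have h : ∫ s in t..(t + δ), (q ⬝ᵥ q) ≤ ∫ s in t..(t + δ),
        (2 * ((q - v₃ • (D *ᵥ yb s)) ⬝ᵥ (q - v₃ • (D *ᵥ yb s))) + 2 * C₁ * v₃ ^ 2) := by
      refine intervalIntegral.integral_mono_on htδ (by simp)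
        (Continuous.intervalIntegrable (by fun_prop) _ _) ?_
      intro s _
      have h1 := nonnegdot (q - (2 * v₃) • (D *ᵥ yb s))
      have h2 : v₃ ^ 2 * ((D *ᵥ yb s) ⬝ᵥ (D *ᵥ yb s)) ≤ v₃ ^ 2 * C₁ :=
        mul_le_mul_of_nonneg_left (hC₁ s) (sq_nonneg _)
      have h3 := dotProduct_comm q (D *ᵥ yb s)
      simp only [sub_dotProduct, dotProduct_sub, smul_dotProduct, dotProduct_smul,
        smul_eq_mul] at h1 ⊢
      rw [h3] at h1 ⊢
      nlinarith
    rw [intervalIntegral.integral_add (Continuous.intervalIntegrable (by fun_prop) _ _) (by simp),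
      intervalIntegral.integral_const_mul, ← hB, intervalIntegral.integral_const,
      intervalIntegral.integral_const] at h
    simp only [smul_eq_mul, add_sub_cancel_left] at h
    linarith
  have s3 : δ * v₂ ^ 2 ≤ 2 * A + 2 * C₂ * v₃ ^ 2 * δ := by
    have h : ∫ s in t..(t + δ), (v₂ ^ 2) ≤ ∫ s in t..(t + δ),
        (2 * (v₂ + (α ⬝ᵥ yb s) * v₃) ^ 2 + 2 * C₂ * v₃ ^ 2) := by
      refine intervalIntegral.integral_mono_on htδ (by simp)
        (Continuous.intervalIntegrable (by fun_prop) _ _) ?_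
      intro s _
      have h2 : v₃ ^ 2 * ((α ⬝ᵥ yb s) ^ 2) ≤ v₃ ^ 2 * C₂ :=
        mul_le_mul_of_nonneg_left (hC₂ s) (sq_nonneg _)
      nlinarith [sq_nonneg (v₂ + 2 * ((α ⬝ᵥ yb s) * v₃))]
    rw [intervalIntegral.integral_add (Continuous.intervalIntegrable (by fun_prop) _ _) (by simp),
      intervalIntegral.integral_const_mul, ← hA, intervalIntegral.integral_const,
      intervalIntegral.integral_const] at h
    simp only [smul_eq_mul, add_sub_cancel_left] at h
    linarith
  have s4 : μ * (v₁ ⬝ᵥ v₁) ≤ q ⬝ᵥ q + (1 / δ) * E := by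
    have h := (hC1 t ht).dotProduct_mulVec_nonneg v₁
    have hqq : v₁ ⬝ᵥ ((Z * Dᵀ * D * Zᵀ) *ᵥ v₁) = q ⬝ᵥ q := by
      have : Z * Dᵀ * D * Zᵀ = (D * Zᵀ)ᵀ * (D * Zᵀ) := by
        simp [Matrix.transpose_mul, Matrix.mul_assoc]
      rw [this, ← mulVec_mulVec, dotProduct_mulVec, vecMul_transpose]
    rw [sub_mulVec, add_mulVec, smul_mulVec, smul_mulVec, one_mulVec] at h
    simp only [star_trivial, dotProduct_sub, dotProduct_add, dotProduct_smul, smul_eq_mul] at h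
    rw [hqq, aux_quad u huc, ← hE] at h
    linarith
  set J := 1 / δ * (A + B + E) with hJ
  have hδJ : A + B + E = δ * J := by rw [hJ]; field_simp
  have hJ0 : 0 ≤ J := by positivity
  have t3 : v₃ ^ 2 ≤ K₃ * J := by
    rw [hK₃, div_mul_eq_mul_div, le_div_iff₀ hκ0]; nlinarith
  have t2 : v₂ ^ 2 ≤ (2 + 2 * C₂ * K₃) * J := by
    have : C₂ * v₃ ^ 2 ≤ C₂ * (K₃ * J) := by gcongr
    have h : δ * v₂ ^ 2 ≤ δ * (2 * J + 2 * C₂ * v₃ ^ 2) := by nlinarith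
    have := le_of_mul_le_mul_left h hδ
    linarith
  have t1 : v₁ ⬝ᵥ v₁ ≤ (2 + 2 * C₁ * K₃) / μ * J := by
    have h1 : C₁ * v₃ ^ 2 ≤ C₁ * (K₃ * J) := by gcongr
    have hEe : E = δ * (1 / δ * E) := by field_simp
    have h : δ * (q ⬝ᵥ q + 1 / δ * E) ≤ δ * (2 * J + 2 * C₁ * v₃ ^ 2) := by
      rw [mul_add, ← hEe]; nlinarith
    have := le_of_mul_le_mul_left h hδ
    rw [div_mul_eq_mul_div, le_div_iff₀ hμ]
    linarith
  rw [ge_iff_le, div_le_iff₀ hK0, hK]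
  linarith
end

section
/- Let P : [0,∞) → Matrix(n,n,ℝ) be continuously differentiable, with P(t) symmetric positive definite for all t, satisfying the CRE Ṗ(t) = A(t)P(t) + P(t)A(t)ᵀ − P(t)C(t)ᵀQ(t)C(t)P(t) + V(t), where the operator norm of A(t) is bounded by k_a > 0, Q(t) is symmetric positive semidefinite with tr(C(t)ᵀQ(t)C(t)) ≤ μ̄_q, and V(t) ≥ v_m·I with v_m > 0, for all t ≥ 0. Then limsup_{t→∞} tr(P(t)⁻¹) ≤ (n·k_a/v_m)·(1 + (1 + μ̄_q·v_m/(n·k_a²))^{1/2}); consequently liminf_{t→∞} λ_min(P(t)) ≥ (v_m/(n·k_a))·(1 + (1 + μ̄_q·v_m/(n·k_a²))^{1/2})⁻¹, i.e., for every ε > 0 there exists T such that P(t) ≥ (β − ε)·I for all t ≥ T, where β := (v_m/(n·k_a))·(1 + (1 + μ̄_q·v_m/(n·k_a²))^{1/2})⁻¹. -/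
open Matrix MeasureTheory Filter

lemma cre_ode (w w' : ℝ → ℝ) (R c δ : ℝ) (hc : 0 < c)
    (hw : ∀ t, 0 ≤ t → HasDerivAt w (w' t) t) (h0 : ∀ t, 0 ≤ t → 0 ≤ w t)
    (h : ∀ t, 0 ≤ t → R + δ ≤ w t → w' t ≤ -c) :
    ∃ T, 0 ≤ T ∧ ∀ t, T ≤ t → w t ≤ R + δ := by
  have h1 : ∃ T, 0 ≤ T ∧ w T ≤ R + δ := by
    by_contra! hcon
    have hd : ∀ t, 0 ≤ t → HasDerivAt (fun t => w t + c * t) (w' t + c * 1) t := fun t ht =>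
      (hw t ht).add ((hasDerivAt_id t).const_mul c)
    have hanti : AntitoneOn (fun t => w t + c * t) (Set.Ici 0) := by
      apply antitoneOn_of_deriv_nonpos (convex_Ici 0)
      · exact fun t ht => (hd t ht).continuousAt.continuousWithinAt
      · intro t ht
        rw [interior_Ici] at ht
        exact (hd t (le_of_lt ht)).differentiableAt.differentiableWithinAt
      · intro t ht
        rw [interior_Ici] at ht
        rw [(hd t (le_of_lt ht)).deriv]
        have := h t (le_of_lt ht) (hcon t (le_of_lt ht)).le
        linarith
    have hs : 0 ≤ (w 0 + 1) / c := div_nonneg (by linarith [h0 0 le_rfl]) hc.le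
    have := hanti (Set.mem_Ici.2 le_rfl) (Set.mem_Ici.2 hs) hs
    simp only at this
    rw [mul_div_cancel₀ _ hc.ne'] at this
    linarith [h0 _ hs]
  obtain ⟨T, hT, hwT⟩ := h1
  refine ⟨T, hT, fun t ht => ?_⟩
  refine image_le_of_deriv_right_lt_deriv_boundary (f := w) (f' := w') (a := T) (b := t)
    (B := fun _ => R + δ) (B' := fun _ => 0) ?_ ?_ hwT (fun x => hasDerivAt_const x _) ?_
    (Set.right_mem_Icc.2 ht)
  · exact fun x hx => (hw x (hT.trans hx.1)).continuousAt.continuousWithinAt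
  · exact fun x hx => (hw x (hT.trans hx.1)).hasDerivWithinAt
  · intro x hx hxe
    have := h x (hT.trans hx.1) hxe.ge
    linarith

section
attribute [local instance] Matrix.linftyOpNormedRing Matrix.linftyOpNormedAlgebra

lemma cre_deriv_inv {n : ℕ} (P : ℝ → Matrix (Fin n) (Fin n) ℝ) (P' : Matrix (Fin n) (Fin n) ℝ)
    (t : ℝ) (hu : IsUnit (P t)) (h : ∀ i j, HasDerivAt (fun τ => P τ i j) (P' i j) t) :
    HasDerivAt (fun τ => ((P τ)⁻¹).trace) (-((P t)⁻¹ * P' * (P t)⁻¹).trace) t := by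
  have h1 : HasDerivAt P P' t :=
    hasDerivAt_pi.2 fun i => hasDerivAt_pi.2 fun j => h i j
  obtain ⟨u, hu⟩ := hu
  have h2 := hasFDerivAt_ringInverse (𝕜 := ℝ) u
  rw [hu] at h2
  have h3 := h2.comp_hasDerivAt t h1
  have h4 := (LinearMap.toContinuousLinearMap
    (Matrix.traceLinearMap (Fin n) ℝ ℝ)).hasFDerivAt.comp_hasDerivAt t h3
  have hi : (↑u⁻¹ : Matrix (Fin n) (Fin n) ℝ) = (P t)⁻¹ := by
    rw [← hu, Matrix.coe_units_inv]
  have e1 : (fun τ => ((P τ)⁻¹).trace) = (LinearMap.toContinuousLinearMap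
    (Matrix.traceLinearMap (Fin n) ℝ ℝ)) ∘ Ring.inverse ∘ P := by
    ext τ
    rw [Matrix.nonsing_inv_eq_ringInverse]
    rfl
  rw [e1]
  refine h4.congr_deriv ?_
  rw [hi]
  change Matrix.trace (-((P t)⁻¹ * P' * (P t)⁻¹)) = _
  rw [Matrix.trace_neg]
end

lemma cre_trace_mul {n : ℕ} (A W : Matrix (Fin n) (Fin n) ℝ) (hW : W.PosSemidef) (k : ℝ)
    (hA : ‖Matrix.toEuclideanCLM (𝕜 := ℝ) A‖ ≤ k) : -(W * A).trace ≤ k * W.trace := by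
  obtain ⟨m, a, rfl⟩ := Matrix.posSemidef_iff_eq_sum_vecMulVec.mp hW
  rw [Finset.sum_mul, Matrix.trace_sum, Matrix.trace_sum, Finset.mul_sum, ← Finset.sum_neg_distrib]
  refine Finset.sum_le_sum fun i _ => ?_
  rw [Matrix.trace_mul_comm, Matrix.mul_vecMulVec, Matrix.trace_vecMulVec, Matrix.trace_vecMulVec,
    star_trivial, dotProduct_comm]
  have h1 := Matrix.inner_toEuclideanCLM A (WithLp.toLp 2 (a i)) (WithLp.toLp 2 (a i))
  have h2 : ‖WithLp.toLp 2 (a i)‖ ^ 2 = a i ⬝ᵥ a i := by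
    rw [EuclideanSpace.norm_sq_eq]
    simp [dotProduct, sq]
  have h3 := abs_real_inner_le_norm (WithLp.toLp 2 (a i))
    (Matrix.toEuclideanCLM (𝕜 := ℝ) A (WithLp.toLp 2 (a i)))
  rw [h1] at h3
  have h4 := ContinuousLinearMap.le_of_opNorm_le _ hA (WithLp.toLp 2 (a i))
  have h5 := mul_le_mul_of_nonneg_left h4 (norm_nonneg (WithLp.toLp 2 (a i)))
  have h6 := neg_abs_le (a i ⬝ᵥ A *ᵥ a i)
  simp only at h3
  rw [← h2]
  nlinarith

lemma cre_le_trace {n : ℕ} (P : Matrix (Fin n) (Fin n) ℝ) (hP : P.PosDef) (x : Fin n → ℝ) :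
    x ⬝ᵥ x ≤ (P⁻¹).trace * (x ⬝ᵥ P *ᵥ x) := by
  obtain ⟨m, a, hW⟩ := Matrix.posSemidef_iff_eq_sum_vecMulVec.mp hP.inv.posSemidef
  have key : ∀ u v : Fin n → ℝ, u ⬝ᵥ P⁻¹ *ᵥ v = ∑ i, (a i ⬝ᵥ u) * (a i ⬝ᵥ v) := by
    intro u v
    rw [hW, Matrix.sum_mulVec, dotProduct_sum]
    refine Finset.sum_congr rfl fun i _ => ?_
    rw [Matrix.vecMulVec_mulVec, star_trivial]
    simp [dotProduct_smul, dotProduct_comm u, mul_comm]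
  have hinv : P⁻¹ *ᵥ (P *ᵥ x) = x := by
    rw [Matrix.mulVec_mulVec, Matrix.nonsing_inv_mul _ ((Matrix.isUnit_iff_isUnit_det _).1 hP.isUnit),
      Matrix.one_mulVec]
  have htr : (P⁻¹).trace = ∑ i, a i ⬝ᵥ a i := by
    rw [hW, Matrix.trace_sum]
    simp [Matrix.trace_vecMulVec]
  have k1 := key x (P *ᵥ x)
  have k2 := key (P *ᵥ x) (P *ᵥ x)
  rw [hinv] at k1 k2
  rw [dotProduct_comm] at k2
  have cs := Finset.sum_mul_sq_le_sq_mul_sq Finset.univ (fun i => a i ⬝ᵥ x) (fun i => a i ⬝ᵥ P *ᵥ x)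
  have h1 : ∑ i, (a i ⬝ᵥ x) ^ 2 ≤ (P⁻¹).trace * (x ⬝ᵥ x) := by
    rw [htr, Finset.sum_mul]
    refine Finset.sum_le_sum fun i _ => ?_
    have := Finset.sum_mul_sq_le_sq_mul_sq Finset.univ (a i) x
    simpa [dotProduct, sq] using this
  have h2 : ∑ i, (a i ⬝ᵥ P *ᵥ x) ^ 2 = x ⬝ᵥ P *ᵥ x := by
    rw [k2]; simp [sq]
  rw [← k1, h2] at cs
  have hq : 0 ≤ x ⬝ᵥ P *ᵥ x := by rw [← h2]; positivity
  have hx : 0 ≤ x ⬝ᵥ x := by simpa using dotProduct_star_self_nonneg x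
  have ht : 0 ≤ (P⁻¹).trace := hP.inv.posSemidef.trace_nonneg
  rcases hx.eq_or_lt with h0 | h0
  · rw [← h0]; positivity
  · have := mul_le_mul_of_nonneg_right h1 hq
    nlinarith

lemma cre_trace_sq {n : ℕ} (W : Matrix (Fin n) (Fin n) ℝ) (hW : W.IsHermitian) :
    W.trace ^ 2 ≤ n * (W * W).trace := by
  have h1 : (W * W).trace = ∑ i, ∑ j, W i j ^ 2 := by
    simp only [Matrix.trace, Matrix.diag, Matrix.mul_apply]
    refine Finset.sum_congr rfl fun i _ => Finset.sum_congr rfl fun j _ => ?_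
    have := hW.apply i j
    simp at this
    rw [this, sq]
  have h2 := sq_sum_le_card_mul_sum_sq (s := (Finset.univ : Finset (Fin n))) (f := fun i => W i i)
  simp only [Finset.card_univ, Fintype.card_fin] at h2
  refine h2.trans ?_
  rw [h1]
  gcongr with i
  exact Finset.single_le_sum (f := fun j => W i j ^ 2) (fun j _ => sq_nonneg _) (Finset.mem_univ i)



/-- Ultimate lower bound of the smallest eigenvalue of the CRE solution when `V(t) ≥ v_m I`:
`limsup tr(P(t)⁻¹) ≤ (n k_a/v_m)(1 + √(1 + μ̄_q v_m/(n k_a²)))`, and consequently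
for every `ε > 0` one eventually has `P(t) ≥ (β − ε) I` where
`β = (v_m/(n k_a)) (1 + √(1 + μ̄_q v_m/(n k_a²)))⁻¹`. -/
theorem cre_ultimate_lower_bound
    (n m : ℕ) (hn : 0 < n)
    (A P V : ℝ → Matrix (Fin n) (Fin n) ℝ)
    (C : ℝ → Matrix (Fin m) (Fin n) ℝ)
    (Q : ℝ → Matrix (Fin m) (Fin m) ℝ)
    (hP : ∀ t, 0 ≤ t → (P t).PosDef)
    (hCRE : ∀ t, 0 ≤ t → ∀ i j, HasDerivAt (fun τ => P τ i j)
      ((A t * P t + P t * (A t)ᵀ - P t * (C t)ᵀ * Q t * C t * P t + V t) i j) t)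
    (k_a : ℝ) (hka : 0 < k_a)
    (hA : ∀ t, 0 ≤ t → ‖Matrix.toEuclideanCLM (𝕜 := ℝ) (A t)‖ ≤ k_a)
    (μq : ℝ) (hQ : ∀ t, 0 ≤ t → (Q t).PosSemidef)
    (hCQ : ∀ t, 0 ≤ t → ((C t)ᵀ * Q t * C t).trace ≤ μq)
    (v_m : ℝ) (hvm : 0 < v_m)
    (hV : ∀ t, 0 ≤ t → (V t - v_m • (1 : Matrix (Fin n) (Fin n) ℝ)).PosSemidef)
    (β : ℝ)
    (hβ : β = (v_m / (n * k_a)) * (1 + Real.sqrt (1 + μq * v_m / (n * k_a ^ 2)))⁻¹) :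
    limsup (fun t => ((P t)⁻¹).trace) atTop ≤
        (n * k_a / v_m) * (1 + Real.sqrt (1 + μq * v_m / (n * k_a ^ 2))) ∧
      ∀ ε > (0 : ℝ), ∃ T : ℝ, ∀ t, T ≤ t →
        (P t - (β - ε) • (1 : Matrix (Fin n) (Fin n) ℝ)).PosSemidef := by
  
  have hn' : (0 : ℝ) < n := by exact_mod_cast hn
  haveI : Nonempty (Fin n) := ⟨⟨0, hn⟩⟩
  set R := (n * k_a / v_m) * (1 + Real.sqrt (1 + μq * v_m / (n * k_a ^ 2))) with hR
  set s := Real.sqrt (1 + μq * v_m / (n * k_a ^ 2)) with hs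
  have hCQ0 : ∀ t, 0 ≤ t → ((C t)ᵀ * Q t * C t).PosSemidef := fun t ht => by
    simpa using (hQ t ht).conjTranspose_mul_mul_same (C t)
  have hμ : 0 ≤ μq := (hCQ0 0 le_rfl).trace_nonneg.trans (hCQ 0 le_rfl)
  have hs0 : 0 ≤ s := Real.sqrt_nonneg _
  have hs2 : s ^ 2 = 1 + μq * v_m / (n * k_a ^ 2) := Real.sq_sqrt (by positivity)
  have hR0 : 0 < R := by positivity
  have hRq : 2 * k_a * R + μq - v_m / n * R ^ 2 = 0 := by
    have e : 2 * k_a * R + μq - v_m / n * R ^ 2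
        = n * k_a ^ 2 / v_m * (1 + μq * v_m / (n * k_a ^ 2) - s ^ 2) := by
      rw [hR]; field_simp; ring
    rw [e, hs2]; ring
  have hRk : 2 * k_a ≤ v_m / n * R := by
    have h8 : v_m / n * R = k_a * (1 + s) := by rw [hR]; field_simp
    have h9 : 1 ≤ s := Real.one_le_sqrt.2 (by
      have : 0 ≤ μq * v_m / (n * k_a ^ 2) := by positivity
      linarith)
    rw [h8]; nlinarith
  have hβR : β = R⁻¹ := by
    rw [hβ, hR, mul_inv, inv_div]
  set w : ℝ → ℝ := fun t => ((P t)⁻¹).trace with hw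
  have hwpos : ∀ t, 0 ≤ t → 0 < w t := fun t ht => (hP t ht).inv.trace_pos
  set w' : ℝ → ℝ := fun t => -((P t)⁻¹ * (A t * P t + P t * (A t)ᵀ - P t * (C t)ᵀ * Q t * C t * P t
    + V t) * (P t)⁻¹).trace with hw'
  have hder : ∀ t, 0 ≤ t → HasDerivAt w (w' t) t := fun t ht =>
    cre_deriv_inv P _ t (hP t ht).isUnit (hCRE t ht)
  have hbound : ∀ t, 0 ≤ t → w' t ≤ 2 * k_a * w t + μq - v_m / n * w t ^ 2 := by
    intro t ht
    have hu := (Matrix.isUnit_iff_isUnit_det _).1 (hP t ht).isUnit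
    have hWP : (P t)⁻¹ * P t = 1 := Matrix.nonsing_inv_mul _ hu
    have hPW : P t * (P t)⁻¹ = 1 := Matrix.mul_nonsing_inv _ hu
    have hWi := (hP t ht).inv
    have hk := cre_trace_mul (A t) _ hWi.posSemidef k_a (hA t ht)
    have hsq := cre_trace_sq _ hWi.isHermitian
    have hVt := ((hV t ht).conjTranspose_mul_mul_same (P t)⁻¹).trace_nonneg
    rw [hWi.isHermitian.eq] at hVt
    have hq := hCQ t ht
    simp only [hw', hw]
    generalize (P t)⁻¹ = W at *
    have hWt : Wᵀ = W := by simpa using hWi.isHermitian.eq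
    have e : W * (A t * P t + P t * (A t)ᵀ - P t * (C t)ᵀ * Q t * C t * P t + V t) * W
        = W * A t + (A t)ᵀ * W - (C t)ᵀ * Q t * C t + W * V t * W := by
      have : W * (A t * P t + P t * (A t)ᵀ - P t * (C t)ᵀ * Q t * C t * P t + V t) * W
        = W * A t * (P t * W) + (W * P t) * (A t)ᵀ * W
          - (W * P t) * ((C t)ᵀ * Q t * C t) * (P t * W) + W * V t * W := by
        simp only [mul_add, add_mul, mul_sub, sub_mul, Matrix.mul_assoc]
      rw [this, hWP, hPW]; simp
    have e2 : ((A t)ᵀ * W).trace = (W * A t).trace := by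
      rw [← Matrix.trace_transpose, Matrix.transpose_mul, Matrix.transpose_transpose, hWt]
    have e3 : (W * (V t - v_m • 1) * W).trace = (W * V t * W).trace - v_m * (W * W).trace := by
      simp [mul_sub, sub_mul]
    rw [e3] at hVt
    rw [e, Matrix.trace_add, Matrix.trace_sub, Matrix.trace_add, e2]
    have h7 : v_m / n * W.trace ^ 2 ≤ v_m * (W * W).trace := by
      rw [div_mul_eq_mul_div, div_le_iff₀ hn']
      nlinarith
    linarith
  have hmain : ∀ δ > 0, ∃ T, 0 ≤ T ∧ ∀ t, T ≤ t → w t ≤ R + δ := by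
    intro δ hδ
    refine cre_ode w w' R (v_m / n * δ ^ 2) δ (by positivity) hder (fun t ht => (hwpos t ht).le) ?_
    intro t ht h
    refine (hbound t ht).trans ?_
    obtain ⟨d, hd, hd2⟩ : ∃ d, w t = R + d ∧ δ ≤ d := ⟨w t - R, by ring, by linarith⟩
    rw [hd]
    have hc : 0 < v_m / n := by positivity
    generalize v_m / n = c at *
    have h1 : δ ^ 2 ≤ d ^ 2 := by gcongr
    have h2 : 0 ≤ d := by linarith
    nlinarith [mul_le_mul_of_nonneg_right hRk h2, mul_le_mul_of_nonneg_left h1 hc.le,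
      mul_nonneg (mul_nonneg hc.le hR0.le) h2]
  constructor
  · refine le_of_forall_pos_le_add fun δ hδ => ?_
    obtain ⟨T, hT0, hT⟩ := hmain δ hδ
    refine limsup_le_of_le ?_ (eventually_atTop.2 ⟨T, hT⟩)
    exact IsCoboundedUnder.of_frequently_ge (a := 0) ((eventually_atTop.2 ⟨0, fun t ht => (hwpos t ht).le⟩).frequently)
  · intro ε hε
    have hlim : ∃ δ > 0, β - ε ≤ (R + δ)⁻¹ := by
      refine ⟨ε * R ^ 2, by positivity, ?_⟩
      rw [hβR, ← one_div (R + _), le_div_iff₀ (by positivity)]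
      have : (R⁻¹ - ε) * (R + ε * R ^ 2) = 1 - ε ^ 2 * R ^ 2 := by field_simp; ring
      rw [this]
      nlinarith [sq_nonneg (ε * R)]
    obtain ⟨δ, hδ, hδ2⟩ := hlim
    obtain ⟨T, hT0, hT⟩ := hmain δ hδ
    refine ⟨T, fun t ht => ?_⟩
    have ht0 := hT0.trans ht
    refine PosSemidef.of_dotProduct_mulVec_nonneg ?_ ?_
    · refine (hP t ht0).isHermitian.sub ?_
      ext i j
      simp [Matrix.one_apply, eq_comm]
    · intro x
      have h1 := cre_le_trace _ (hP t ht0) x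
      have h2 : 0 ≤ x ⬝ᵥ P t *ᵥ x := by
        simpa using (hP t ht0).posSemidef.dotProduct_mulVec_nonneg x
      have h3 : x ⬝ᵥ x ≤ (R + δ) * (x ⬝ᵥ P t *ᵥ x) :=
        h1.trans (mul_le_mul_of_nonneg_right (hT t ht) h2)
      have hx : 0 ≤ x ⬝ᵥ x := by simpa using dotProduct_star_self_nonneg x
      have h4 : (R + δ)⁻¹ * (x ⬝ᵥ x) ≤ x ⬝ᵥ P t *ᵥ x := by
        rw [inv_mul_le_iff₀ (by positivity)]; exact h3
      have h5 := mul_le_mul_of_nonneg_right hδ2 hx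
      simp only [star_trivial, Matrix.sub_mulVec, Matrix.smul_mulVec, Matrix.one_mulVec,
        dotProduct_sub, dotProduct_smul, smul_eq_mul]
      linarith
end
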